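/- Let T₁, T₂ be two minimal actions of a group G on ℝ-trees such that the core C(T₁ × T₂) is non-empty. Then T₁ and T₂ have a common refinement if and only if C is 1-dimensional, i.e. C contains no rectangle I₁ × I₂ with both I₁ ⊂ T₁ and I₂ ⊂ T₂ non-degenerate arcs. -/

import Mathlib

/-!
Formalization of definitions from V. Guirardel,
"Core and intersection number for group actions on trees".
-/

open Set Metric Filter Function Topology
open scoped ENNReal Pointwise

noncomputable section

namespace Guirardel

/-- The metric segment `[x,y]`: the set of points lying metrically between `x` and `y`.
In an `ℝ`-tree this is the image of the geodesic from `x` to `y`. -/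
def seg {T : Type*} [MetricSpace T] (x y : T) : Set T :=
  {p : T | dist x p + dist p y = dist x y}

/-- The open segment `]x,y[`. -/
def openSeg {T : Type*} [MetricSpace T] (x y : T) : Set T :=
  seg x y \ {x, y}

/-- A subset of an `ℝ`-tree is convex (i.e. a subtree when nonempty) if it contains the
segment between any two of its points. -/
def TreeConvex {T : Type*} [MetricSpace T] (S : Set T) : Prop :=
  ∀ x ∈ S, ∀ y ∈ S, seg x y ⊆ S

/-- An `ℝ`-tree: any two points are joined by a geodesic, and any two injective paths
with the same endpoints have the same image (uniqueness of arcs). -/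
structure IsRTree (T : Type*) [MetricSpace T] : Prop where
  exists_geod : ∀ x y : T, ∃ f : ℝ → T, f 0 = x ∧ f (dist x y) = y ∧
    ∀ s ∈ Icc (0 : ℝ) (dist x y), ∀ t ∈ Icc (0 : ℝ) (dist x y),
      dist (f s) (f t) = |s - t|
  arc_unique : ∀ (x y : T) (γ₁ γ₂ : Path x y),
    Function.Injective γ₁ → Function.Injective γ₂ →
      Set.range γ₁ = Set.range γ₂

/-- A direction based at `x`: a connected component of the complement of `x`. -/
def IsDirectionAt {T : Type*} [MetricSpace T] (δ : Set T) (x : T) : Prop :=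
  ∃ y : T, y ≠ x ∧ δ = connectedComponentIn {x}ᶜ y

/-- A direction in a tree. -/
def IsDirection {T : Type*} [MetricSpace T] (δ : Set T) : Prop :=
  ∃ x : T, IsDirectionAt δ x

/-- A branch point: a point with at least three directions. -/
def IsBranchPoint {T : Type*} [MetricSpace T] (x : T) : Prop :=
  ∃ δ₁ δ₂ δ₃ : Set T, IsDirectionAt δ₁ x ∧ IsDirectionAt δ₂ x ∧ IsDirectionAt δ₃ x ∧
    δ₁ ≠ δ₂ ∧ δ₁ ≠ δ₃ ∧ δ₂ ≠ δ₃

/-- A quadrant in `T₁ × T₂`: a product of two directions. -/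
def IsQuadrant {T₁ T₂ : Type*} [MetricSpace T₁] [MetricSpace T₂]
    (Q : Set (T₁ × T₂)) : Prop :=
  ∃ (δ₁ : Set T₁) (δ₂ : Set T₂), IsDirection δ₁ ∧ IsDirection δ₂ ∧ Q = δ₁ ×ˢ δ₂

/-- A quadrant is heavy if (for every choice of base point, which does not matter) there
is a sequence of orbit points inside it whose two coordinates go to infinity. -/
def Heavy (G : Type*) {T₁ T₂ : Type*} [Group G] [MetricSpace T₁] [MetricSpace T₂]
    [MulAction G T₁] [MulAction G T₂] (Q : Set (T₁ × T₂)) : Prop :=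
  ∀ p : T₁ × T₂, ∃ γ : ℕ → G,
    (∀ k, ((γ k • p.1 : T₁), (γ k • p.2 : T₂)) ∈ Q) ∧
    Tendsto (fun k => dist (γ k • p.1) p.1) atTop atTop ∧
    Tendsto (fun k => dist (γ k • p.2) p.2) atTop atTop

/-- The core of `T₁ × T₂`: the complement of the union of all light (i.e. non-heavy)
quadrants; equivalently the set of points all of whose quadrants are heavy. -/
def Core (G T₁ T₂ : Type*) [Group G] [MetricSpace T₁] [MetricSpace T₂]
    [MulAction G T₁] [MulAction G T₂] : Set (T₁ × T₂) :=
  {z : T₁ × T₂ | ∀ Q : Set (T₁ × T₂), IsQuadrant Q → z ∈ Q → Heavy G Q}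

/-- A subset of `T₁ × T₂` has convex fibers if its horizontal and vertical fibers
are convex. -/
def ConvexFibers {T₁ T₂ : Type*} [MetricSpace T₁] [MetricSpace T₂]
    (E : Set (T₁ × T₂)) : Prop :=
  (∀ x₁ : T₁, TreeConvex {y₂ : T₂ | (x₁, y₂) ∈ E}) ∧
  (∀ x₂ : T₂, TreeConvex {y₁ : T₁ | (y₁, x₂) ∈ E})

/-- The action of `G` on `T` is by isometries. -/
def IsometricAction (G T : Type*) [MetricSpace T] [SMul G T] : Prop :=
  ∀ (g : G) (x y : T), dist (g • x) (g • y) = dist x y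

/-- `g` is elliptic: it fixes a point of `T`. -/
def Elliptic {G : Type*} (T : Type*) [SMul G T] (g : G) : Prop :=
  ∃ x : T, g • x = x

/-- `g` is hyperbolic: it fixes no point of `T`. -/
def Hyperbolic {G : Type*} (T : Type*) [SMul G T] (g : G) : Prop :=
  ∀ x : T, g • x ≠ x

/-- Translation length of `g` on `T`. -/
def translationLength {G : Type*} (T : Type*) [MetricSpace T] [SMul G T] (g : G) : ℝ :=
  ⨅ x : T, dist x (g • x)

/-- The axis (characteristic set) of `g`: points minimizing displacement. -/
def axisSet {G : Type*} (T : Type*) [MetricSpace T] [SMul G T] (g : G) : Set T :=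
  {x : T | ∀ y : T, dist x (g • x) ≤ dist y (g • y)}

/-- The action is non-trivial: some element is hyperbolic. -/
def NontrivialAction (G T : Type*) [SMul G T] : Prop :=
  ∃ g : G, ∀ x : T, g • x ≠ x

/-- The action is free: only the identity fixes a point. -/
def FreeAction (G T : Type*) [Group G] [MulAction G T] : Prop :=
  ∀ g : G, g ≠ 1 → ∀ x : T, g • x ≠ x

/-- The action is minimal: no proper nonempty invariant subtree. -/
def MinimalAction (G T : Type*) [MetricSpace T] [SMul G T] : Prop :=
  ∀ S : Set T, S.Nonempty → TreeConvex S → (∀ g : G, ∀ x ∈ S, g • x ∈ S) → S = univ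

/-- The minimal subtree for the subset `H` of `G`: the intersection of all nonempty
invariant subtrees. -/
def minSubtreeOf {G : Type*} (H : Set G) (T : Type*) [MetricSpace T] [SMul G T] : Set T :=
  ⋂₀ {S : Set T | S.Nonempty ∧ TreeConvex S ∧ ∀ g ∈ H, ∀ x ∈ S, g • x ∈ S}

/-- The minimal subtree of the `G`-action. -/
def minSubtree (G T : Type*) [MetricSpace T] [SMul G T] : Set T :=
  minSubtreeOf (univ : Set G) T

/-- A line in `T`: the image of an isometric embedding of `ℝ`. -/
def IsLine {T : Type*} [MetricSpace T] (L : Set T) : Prop :=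
  ∃ f : ℝ → T, (∀ s t : ℝ, dist (f s) (f t) = |s - t|) ∧ L = range f

/-- A ray in `T`: the image of an isometric embedding of `[0,∞)`. -/
def IsRay {T : Type*} [MetricSpace T] (R : Set T) : Prop :=
  ∃ f : ℝ → T, (∀ s ∈ Ici (0 : ℝ), ∀ t ∈ Ici (0 : ℝ), dist (f s) (f t) = |s - t|) ∧
    R = f '' Ici 0

/-- Two rays (or subsets) define the same end when they are at finite Hausdorff distance. -/
def SameEnd {T : Type*} [MetricSpace T] (R R' : Set T) : Prop :=
  EMetric.hausdorffEdist R R' ≠ ⊤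

/-- The action of `G` fixes an end of `T`. -/
def GFixedEnd (G T : Type*) [MetricSpace T] [SMul G T] : Prop :=
  ∃ R : Set T, IsRay R ∧ ∀ g : G, SameEnd ((fun x => g • x) '' R) R

/-- The action of `G` has an invariant line. -/
def GInvariantLine (G T : Type*) [MetricSpace T] [SMul G T] : Prop :=
  ∃ L : Set T, IsLine L ∧ ∀ g : G, (fun x => g • x) '' L = L

/-- The action is irreducible: no invariant line and no fixed end. -/
def IrreducibleAction (G T : Type*) [MetricSpace T] [SMul G T] : Prop :=
  ¬ GInvariantLine G T ∧ ¬ GFixedEnd G T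

/-- The action is dihedral: there is an invariant line on which some element acts as a
reflection (i.e. with non-constant displacement along the line). -/
def DihedralAction (G T : Type*) [MetricSpace T] [SMul G T] : Prop :=
  ∃ L : Set T, IsLine L ∧ (∀ g : G, (fun x => g • x) '' L = L) ∧
    ∃ g : G, ∃ x ∈ L, ∃ y ∈ L, dist x (g • x) ≠ dist y (g • y)

/-- `A` is a positive semi-axis of `g`: a ray contained in the axis of `g` and mapped
into itself by `g`. -/
def PosSemiAxis {G : Type*} (T : Type*) [MetricSpace T] [SMul G T] (g : G) (A : Set T) :
    Prop :=
  IsRay A ∧ A ⊆ axisSet T g ∧ (fun x => g • x) '' A ⊆ A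

/-- `g` translates towards the end determined by the ray `R`:
`g` is hyperbolic and has a positive semi-axis defining the same end as `R`. -/
def TranslatesToward {G : Type*} (T : Type*) [MetricSpace T] [SMul G T] (g : G)
    (R : Set T) : Prop :=
  Hyperbolic T g ∧ ∃ A : Set T, PosSemiAxis T g A ∧ SameEnd A R

/-- The end `ω_T(g)` of the hyperbolic element `g` lies in the set of ends of `δ`:
some positive semi-axis of `g` is contained in `δ`. -/
def EndInSubtree {G : Type*} (T : Type*) [MetricSpace T] [SMul G T] (g : G)
    (δ : Set T) : Prop :=
  ∃ A : Set T, PosSemiAxis T g A ∧ A ⊆ δ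

/-- A map between `ℝ`-trees preserves alignment if the image of a point between `y`
and `z` lies between the images of `y` and `z`. -/
def AlignPreserving {T T' : Type*} [MetricSpace T] [MetricSpace T'] (f : T → T') : Prop :=
  ∀ x y z : T, x ∈ seg y z → f x ∈ seg (f y) (f z)

/-- `f : T → T'` witnesses that `T` is a refinement of `T'`: it is an equivariant
continuous surjection preserving alignment. -/
def IsRefinementMap (G : Type*) {T T' : Type*} [Group G] [MetricSpace T] [MetricSpace T']
    [MulAction G T] [MulAction G T'] (f : T → T') : Prop :=
  Continuous f ∧ Surjective f ∧ AlignPreserving f ∧ ∀ (g : G) (x : T), f (g • x) = g • f x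

/-- The length functions of the two actions are homothetic. -/
def HomotheticLengths (G T₁ T₂ : Type*) [MetricSpace T₁] [MetricSpace T₂] [SMul G T₁]
    [SMul G T₂] : Prop :=
  ∃ c : ℝ, 0 < c ∧ ∀ g : G, translationLength T₁ g = c * translationLength T₂ g

/-- A bundled `ℝ`-tree with an isometric action of `G`. -/
structure GTree (G : Type*) [Group G] where
  carrier : Type
  [ms : MetricSpace carrier]
  [ma : MulAction G carrier]
  isom : ∀ (g : G) (x y : carrier), dist (g • x) (g • y) = dist x y
  tree : IsRTree carrier

attribute [instance] GTree.ms GTree.ma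

/-- A simplicial structure on an `ℝ`-tree: a vertex set containing all branch points,
meeting every segment in a finite set, and discrete. -/
def IsSimplicialStructure {T : Type*} [MetricSpace T] (V : Set T) : Prop :=
  (∀ x : T, IsBranchPoint x → x ∈ V) ∧
  (∀ x y : T, (seg x y ∩ V).Finite) ∧
  (∀ v ∈ V, ∃ ε > 0, ∀ w ∈ V, dist v w < ε → w = v)

/-- Two vertices of a simplicial tree are adjacent (span an edge). -/
def Adjacent {T : Type*} [MetricSpace T] (V : Set T) (v w : T) : Prop :=
  v ∈ V ∧ w ∈ V ∧ v ≠ w ∧ seg v w ∩ V = {v, w}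

/-- A bundled simplicial `G`-tree. -/
structure SimplicialGTree (G : Type*) [Group G] extends GTree G where
  V : Set carrier
  simp : IsSimplicialStructure V
  inv : ∀ g : G, (fun x => g • x) '' V = V

/-- `T₁` and `T₂` are refinements of a common non-trivial simplicial action of `G`. -/
def RefineCommonSimplicial (G T₁ T₂ : Type*) [Group G] [MetricSpace T₁] [MetricSpace T₂]
    [MulAction G T₁] [MulAction G T₂] : Prop :=
  ∃ T' : SimplicialGTree G, NontrivialAction G T'.carrier ∧
    (∃ f₁ : T₁ → T'.carrier, IsRefinementMap G f₁) ∧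
    (∃ f₂ : T₂ → T'.carrier, IsRefinementMap G f₂)

/-- Two directions face each other: their union is the whole tree. -/
def FacingDirections {T : Type*} [MetricSpace T] (δ δ' : Set T) : Prop :=
  δ ∪ δ' = univ

/-- There is a twice-light rectangle with (opposite) base corners `x` and `x'`:
two light quadrants based at `x` and `x'` facing each other. -/
def IsTwiceLightRect (G : Type*) {T₁ T₂ : Type*} [Group G] [MetricSpace T₁]
    [MetricSpace T₂] [MulAction G T₁] [MulAction G T₂] (x x' : T₁ × T₂) : Prop :=
  ∃ (δ₁ : Set T₁) (δ₂ : Set T₂) (δ₁' : Set T₁) (δ₂' : Set T₂),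
    IsDirectionAt δ₁ x.1 ∧ IsDirectionAt δ₂ x.2 ∧
    IsDirectionAt δ₁' x'.1 ∧ IsDirectionAt δ₂' x'.2 ∧
    x.1 ≠ x'.1 ∧ x.2 ≠ x'.2 ∧
    FacingDirections δ₁ δ₁' ∧ FacingDirections δ₂ δ₂' ∧
    ¬ Heavy G (δ₁ ×ˢ δ₂) ∧ ¬ Heavy G (δ₁' ×ˢ δ₂')

/-- The open rectangle with opposite corners `x, x'`. -/
def openRect {T₁ T₂ : Type*} [MetricSpace T₁] [MetricSpace T₂] (x x' : T₁ × T₂) :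
    Set (T₁ × T₂) :=
  openSeg x.1 x'.1 ×ˢ openSeg x.2 x'.2

/-- A maximal twice-light rectangle. -/
def IsMaxTwiceLightRect (G : Type*) {T₁ T₂ : Type*} [Group G] [MetricSpace T₁]
    [MetricSpace T₂] [MulAction G T₁] [MulAction G T₂] (x x' : T₁ × T₂) : Prop :=
  IsTwiceLightRect G x x' ∧ ∀ y y' : T₁ × T₂, IsTwiceLightRect G y y' →
    openRect x x' ⊆ openRect y y' → openRect x x' = openRect y y'

/-- The straight diagonal of a rectangle joining the two opposite corners `p` and `q`. -/
def mainDiag {T₁ T₂ : Type*} [MetricSpace T₁] [MetricSpace T₂] (p q : T₁ × T₂) :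
    Set (T₁ × T₂) :=
  {z : T₁ × T₂ | z.1 ∈ seg p.1 q.1 ∧ z.2 ∈ seg p.2 q.2 ∧
    dist p.1 z.1 * dist p.2 q.2 = dist p.2 z.2 * dist p.1 q.1}

/-- The augmented core: the union of the core and of the main diagonals of the maximal
twice-light rectangles (the diagonals joining the two opposite corners lying in the core). -/
def AugCore (G T₁ T₂ : Type*) [Group G] [MetricSpace T₁] [MetricSpace T₂]
    [MulAction G T₁] [MulAction G T₂] : Set (T₁ × T₂) :=
  Core G T₁ T₂ ∪
    {z : T₁ × T₂ | ∃ x x' p q : T₁ × T₂, IsMaxTwiceLightRect G x x' ∧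
      p ∈ Core G T₁ T₂ ∧ q ∈ Core G T₁ T₂ ∧
      ({p.1, q.1} : Set T₁) = {x.1, x'.1} ∧ ({p.2, q.2} : Set T₂) = {x.2, x'.2} ∧
      p.1 ≠ q.1 ∧ p.2 ≠ q.2 ∧ z ∈ mainDiag p q}

/-- There exists an equivariant (strong) deformation retraction of `T₁ × T₂` onto `C`. -/
def EquivDeformRetract (G : Type*) {T₁ T₂ : Type*} [Group G] [MetricSpace T₁]
    [MetricSpace T₂] [MulAction G T₁] [MulAction G T₂] (C : Set (T₁ × T₂)) : Prop :=
  ∃ H : ℝ → T₁ × T₂ → T₁ × T₂,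
    Continuous (fun p : ℝ × (T₁ × T₂) => H p.1 p.2) ∧
    (∀ z : T₁ × T₂, H 0 z = z) ∧
    (∀ z : T₁ × T₂, H 1 z ∈ C) ∧
    (∀ t : ℝ, ∀ z ∈ C, H t z = z) ∧
    (∀ (t : ℝ) (g : G) (z : T₁ × T₂), H t (g • z) = g • H t z)

/-- The `ℓ²` product distance on `T₁ × T₂`. -/
def dist2 {T₁ T₂ : Type*} [MetricSpace T₁] [MetricSpace T₂] (p q : T₁ × T₂) : ℝ :=
  Real.sqrt (dist p.1 q.1 ^ 2 + dist p.2 q.2 ^ 2)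

/-- The length of a path `c : [0,1] → T₁ × T₂`, measured with the `ℓ²` product metric. -/
def pathLen2 {T₁ T₂ : Type*} [MetricSpace T₁] [MetricSpace T₂] (c : ℝ → T₁ × T₂) :
    ℝ≥0∞ :=
  ⨆ (n : ℕ) (u : Fin (n + 1) → ℝ) (_ : Monotone u) (_ : ∀ i, u i ∈ Icc (0 : ℝ) 1),
    ∑ i : Fin n, ENNReal.ofReal (dist2 (c (u i.castSucc)) (c (u i.succ)))

/-- The path metric induced on a subset `C ⊆ T₁ × T₂` by the `ℓ²` product metric. -/
def pathDistOn {T₁ T₂ : Type*} [MetricSpace T₁] [MetricSpace T₂] (C : Set (T₁ × T₂))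
    (x y : C) : ℝ :=
  (⨅ (c : ℝ → T₁ × T₂) (_ : ContinuousOn c (Icc (0 : ℝ) 1))
      (_ : MapsTo c (Icc (0 : ℝ) 1) C) (_ : c 0 = (x : T₁ × T₂))
      (_ : c 1 = (y : T₁ × T₂)), pathLen2 c).toReal

/-- A distance function makes a set a CAT(0) space: it is a metric, geodesic, and the
CN-inequality of Bruhat–Tits holds (comparison triangles are at least as thick). -/
structure IsCAT0Dist {X : Type*} (d : X → X → ℝ) : Prop where
  refl : ∀ x, d x x = 0
  symm : ∀ x y, d x y = d y x
  triangle : ∀ x y z, d x z ≤ d x y + d y z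
  eq_of_dist_eq_zero : ∀ x y, d x y = 0 → x = y
  geodesic : ∀ x y, ∃ f : ℝ → X, f 0 = x ∧ f (d x y) = y ∧
    ∀ s ∈ Icc (0 : ℝ) (d x y), ∀ t ∈ Icc (0 : ℝ) (d x y), d (f s) (f t) = |s - t|
  cn : ∀ x y z m, d y m = d y z / 2 → d m z = d y z / 2 →
    d x m ^ 2 ≤ (d x y ^ 2 + d x z ^ 2) / 2 - d y z ^ 2 / 4

/-- A 2-cell of the core of a product of two simplicial trees: a rectangle which is a
product of two edges and is contained in the core. -/
def IsCoreCell (G : Type*) {T₁ T₂ : Type*} [Group G] [MetricSpace T₁] [MetricSpace T₂]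
    [MulAction G T₁] [MulAction G T₂] (V₁ : Set T₁) (V₂ : Set T₂)
    (R : Set (T₁ × T₂)) : Prop :=
  ∃ v₁ w₁ v₂ w₂, Adjacent V₁ v₁ w₁ ∧ Adjacent V₂ v₂ w₂ ∧
    R = seg v₁ w₁ ×ˢ seg v₂ w₂ ∧ R ⊆ Core G T₁ T₂


/-- Gromov's four point condition with constant zero. -/
def FourPoint (T : Type*) [MetricSpace T] : Prop :=
  ∀ a b c e : T, dist a b + dist c e ≤ max (dist a c + dist b e) (dist a e + dist b c)

/-- Every pair of points has intermediate points at all prescribed distances. -/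
def HasIntermediatePoints (T : Type*) [MetricSpace T] : Prop :=
  ∀ x y : T, ∀ t ∈ Icc (0 : ℝ) (dist x y), ∃ p : T, dist x p = t ∧ dist p y = dist x y - t

section FourPointSpaces

variable {T : Type*} [MetricSpace T]

lemma FourPoint.cases (h : FourPoint T) (a b c e : T) :
    dist a b + dist c e ≤ dist a c + dist b e ∨ dist a b + dist c e ≤ dist a e + dist b c :=
  le_max_iff.1 (h a b c e)

lemma mem_seg {x y p : T} : p ∈ seg x y ↔ dist x p + dist p y = dist x y := Iff.rfl

lemma seg_comm (x y : T) : seg x y = seg y x := by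
  ext p
  rw [mem_seg, mem_seg, dist_comm x p, dist_comm p y, dist_comm x y, add_comm]

lemma left_mem_seg (x y : T) : x ∈ seg x y := by simp [mem_seg]

lemma right_mem_seg (x y : T) : y ∈ seg x y := by simp [mem_seg]

/-- In a four point space, the distance to a point of a segment is controlled by one of the
endpoints. -/
lemma FourPoint.dist_of_mem_seg (h : FourPoint T) {a c z : T} (hz : z ∈ seg a c) (x : T) :
    dist x z + dist a z = dist x a ∨ dist x z + dist c z = dist x c := by
  rw [mem_seg] at hz
  have h1 := dist_triangle x z a
  have h2 := dist_triangle x z c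
  have h3 := dist_comm z a
  have h4 := dist_comm z c
  rcases h.cases x z a c with h | h
  · left; linarith
  · right; linarith [dist_comm z a]

/-- Points of a segment are determined up to the distance of their parameters. -/
lemma FourPoint.dist_of_mem_seg_of_mem_seg (h : FourPoint T) {x y p q : T} (hp : p ∈ seg x y)
    (hq : q ∈ seg x y) : dist p q = |dist x p - dist x q| := by
  rw [mem_seg] at hp hq
  have h1 := abs_dist_sub_le p q x
  rw [dist_comm p x, dist_comm q x] at h1
  refine le_antisymm ?_ h1
  have h2 := dist_comm y p
  have h3 := dist_comm y q
  rw [le_abs]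
  rcases h.cases x y p q with h | h
  · left; linarith
  · right; linarith

lemma FourPoint.eq_of_mem_seg (h : FourPoint T) {x y p q : T} (hp : p ∈ seg x y)
    (hq : q ∈ seg x y) (hpq : dist x p = dist x q) : p = q := by
  rw [← dist_eq_zero, h.dist_of_mem_seg_of_mem_seg hp hq, hpq, sub_self, abs_zero]

lemma FourPoint.mem_seg_of_dist_le (h : FourPoint T) {x y p q : T} (hp : p ∈ seg x y)
    (hq : q ∈ seg x y) (hpq : dist x p ≤ dist x q) : p ∈ seg x q := by
  have := h.dist_of_mem_seg_of_mem_seg hp hq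
  rw [abs_of_nonpos (by linarith)] at this
  rw [mem_seg]; linarith

lemma HasIntermediatePoints.exists_median (hg : HasIntermediatePoints T) (h : FourPoint T)
    (a b c : T) : ∃ m, m ∈ seg a b ∧ m ∈ seg b c ∧ m ∈ seg a c := by
  obtain ⟨m, h1, h2⟩ := hg a b ((dist a b + dist a c - dist b c) / 2)
    ⟨by linarith [dist_triangle b a c, dist_comm a b],
      by linarith [dist_triangle a b c]⟩
  have hm : m ∈ seg a b := by rw [mem_seg]; linarith
  refine ⟨m, hm, ?_, ?_⟩ <;> rw [mem_seg]
  · rcases h.dist_of_mem_seg hm c with h | h <;>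
      linarith [dist_comm b m, dist_comm c m, dist_comm c a, dist_comm c b]
  · rcases h.dist_of_mem_seg hm c with h | h <;>
      linarith [dist_comm b m, dist_comm c m, dist_comm c a, dist_comm c b]

/-- Away from `p`, the condition `p ∈ [x, w]` is locally constant in `w`. -/
lemma FourPoint.mem_seg_of_dist_lt (h : FourPoint T) {x p w w' : T} (hp : p ∈ seg x w)
    (hw : dist w w' < dist p w) : p ∈ seg x w' := by
  rw [mem_seg] at *
  have h1 := dist_triangle x p w'
  rcases h.cases x w p w' with h | h
  · linarith [dist_nonneg (x := p) (y := w')]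
  · linarith [dist_comm p w]

lemma isClosed_setOf_mem_seg (x p : T) : IsClosed {w : T | p ∈ seg x w} :=
  isClosed_eq (by fun_prop) (by fun_prop)

lemma FourPoint.isOpen_setOf_mem_seg (h : FourPoint T) (x p : T) :
    IsOpen {w : T | p ∈ seg x w ∧ w ≠ p} := by
  rw [Metric.isOpen_iff]
  rintro w ⟨hw, hne⟩
  refine ⟨dist p w, dist_pos.2 hne.symm, fun w' hw' => ?_⟩
  rw [Metric.mem_ball, dist_comm] at hw'
  refine ⟨h.mem_seg_of_dist_lt hw hw', ?_⟩
  rintro rfl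
  rw [dist_comm] at hw'
  exact lt_irrefl _ hw'

/-- A preconnected set avoiding `p` lies entirely on one side of `p`. -/
lemma FourPoint.mem_seg_of_isPreconnected (h : FourPoint T) {S : Set T} (hS : IsPreconnected S)
    {p x w w' : T} (hp : p ∉ S) (hw : w ∈ S) (hw' : w' ∈ S) (hx : p ∈ seg x w) :
    p ∈ seg x w' := by
  by_contra hc
  obtain ⟨v, hv, ⟨hv1, -⟩, hv2⟩ := hS _ _ (h.isOpen_setOf_mem_seg x p)
    (isClosed_setOf_mem_seg x p).isOpen_compl
    (fun v hv => by
      by_cases hpv : p ∈ seg x v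
      · exact Or.inl ⟨hpv, fun h => hp (h ▸ hv)⟩
      · exact Or.inr hpv)
    ⟨w, hw, hx, fun h => hp (h ▸ hw)⟩ ⟨w', hw', hc⟩
  exact hv2 hv1

lemma FourPoint.mem_of_isPreconnected (h : FourPoint T) {S : Set T} (hS : IsPreconnected S)
    {x y p : T} (hx : x ∈ S) (hy : y ∈ S) (hp : p ∈ seg x y) : p ∈ S := by
  by_contra hc
  have := h.mem_seg_of_isPreconnected hS hc hy hx hp
  rw [mem_seg, dist_self, dist_comm p x] at this
  exact hc ((dist_eq_zero.1 (by linarith : dist x p = 0)) ▸ hx)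

lemma FourPoint.range_eq_seg (h : FourPoint T) (hg : HasIntermediatePoints T) {x y : T}
    (γ : Path x y) (hγ : Function.Injective γ) : Set.range γ = seg x y := by
  have hpre : ∀ s : Set unitInterval, s.OrdConnected → IsPreconnected (γ '' s) := fun s hs =>
    hs.isPreconnected.image _ γ.continuous.continuousOn
  ext w
  constructor
  · rintro ⟨s, rfl⟩
    obtain ⟨m, hm1, hm2, hm3⟩ := hg.exists_median h x y (γ s)
    obtain ⟨t, ht, htm⟩ := h.mem_of_isPreconnected (hpre (Icc 0 s) ordConnected_Icc)
      ⟨0, ⟨le_rfl, s.2.1⟩, γ.source⟩ ⟨s, ⟨s.2.1, le_rfl⟩, rfl⟩ hm3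
    obtain ⟨t', ht', htm'⟩ := h.mem_of_isPreconnected (hpre (Icc s 1) ordConnected_Icc)
      ⟨1, ⟨s.2.2, le_rfl⟩, γ.target⟩ ⟨s, ⟨le_rfl, s.2.2⟩, rfl⟩ hm2
    have htt : t = t' := hγ (htm.trans htm'.symm)
    subst htt
    rw [le_antisymm ht'.1 ht.2, htm]
    exact hm1
  · intro hw
    rw [← Set.image_univ]
    exact h.mem_of_isPreconnected (hpre univ ordConnected_univ) ⟨0, trivial, γ.source⟩
      ⟨1, trivial, γ.target⟩ hw

lemma FourPoint.isRTree (h : FourPoint T) (hg : HasIntermediatePoints T) : IsRTree T where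
  exists_geod x y := by
    have : Nonempty T := ⟨x⟩
    choose! f hf using hg x y
    have hmem : ∀ t ∈ Icc (0 : ℝ) (dist x y), f t ∈ seg x y := fun t ht => by
      rw [mem_seg, (hf t ht).1, (hf t ht).2]; ring
    refine ⟨f, ?_, ?_, fun s hs t ht => ?_⟩
    · exact (dist_eq_zero.1 (hf 0 ⟨le_rfl, dist_nonneg⟩).1).symm
    · exact dist_eq_zero.1 (by simpa using (hf _ ⟨dist_nonneg, le_rfl⟩).2)
    · rw [h.dist_of_mem_seg_of_mem_seg (hmem s hs) (hmem t ht), (hf s hs).1, (hf t ht).1]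
  arc_unique x y γ₁ γ₂ h₁ h₂ := by rw [h.range_eq_seg hg γ₁ h₁, h.range_eq_seg hg γ₂ h₂]

end FourPointSpaces

section RTrees

variable {T : Type*} [MetricSpace T]

/-- A nondegenerate geodesic gives an injective path with the same image. -/
lemma exists_path_of_geodesic {x y : T} {f : ℝ → T} (hxy : x ≠ y) (hf0 : f 0 = x)
    (hf1 : f (dist x y) = y) (hf : ∀ s ∈ Icc (0 : ℝ) (dist x y), ∀ t ∈ Icc (0 : ℝ) (dist x y),
      dist (f s) (f t) = |s - t|) :
    ∃ γ : Path x y, Function.Injective γ ∧ Set.range γ ⊆ f '' Icc (0 : ℝ) (dist x y) := by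
  have hpos : 0 < dist x y := dist_pos.2 hxy
  have hmem : ∀ t : unitInterval, (t : ℝ) * dist x y ∈ Icc (0 : ℝ) (dist x y) := fun t =>
    ⟨mul_nonneg t.2.1 dist_nonneg, mul_le_of_le_one_left dist_nonneg t.2.2⟩
  have hd : ∀ s t : unitInterval,
      dist (f (s * dist x y)) (f (t * dist x y)) = |(s : ℝ) - t| * dist x y := fun s t => by
    rw [hf _ (hmem s) _ (hmem t), ← sub_mul, abs_mul, abs_of_pos hpos]
  have hcont : Continuous fun t : unitInterval => f (t * dist x y) := by
    have hL : LipschitzWith (nndist x y) fun t : unitInterval => f (t * dist x y) :=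
      LipschitzWith.of_dist_le_mul fun s t => by
        rw [hd, coe_nndist, mul_comm, Subtype.dist_eq, Real.dist_eq]
    exact hL.continuous
  refine ⟨⟨⟨fun t => f (t * dist x y), hcont⟩, by simpa using hf0, by simpa using hf1⟩, ?_, ?_⟩
  · intro s t hst
    have hst' : dist (f (s * dist x y)) (f (t * dist x y)) = 0 := dist_eq_zero.2 hst
    rw [hd, mul_eq_zero, or_iff_left hpos.ne', abs_eq_zero, sub_eq_zero] at hst'
    exact Subtype.ext hst'
  · rintro _ ⟨t, rfl⟩
    exact ⟨_, hmem t, rfl⟩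

lemma geodesic_mem_seg {x y : T} {f : ℝ → T} (hf0 : f 0 = x)
    (hf1 : f (dist x y) = y) (hf : ∀ s ∈ Icc (0 : ℝ) (dist x y), ∀ t ∈ Icc (0 : ℝ) (dist x y),
      dist (f s) (f t) = |s - t|) {t : ℝ} (ht : t ∈ Icc (0 : ℝ) (dist x y)) :
    dist x (f t) = t ∧ dist (f t) y = dist x y - t := by
  have h0 := hf 0 ⟨le_rfl, dist_nonneg⟩ t ht
  have h1 := hf t ht _ ⟨dist_nonneg, le_rfl⟩
  rw [hf0, zero_sub, abs_neg, abs_of_nonneg ht.1] at h0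
  rw [hf1, abs_sub_comm, abs_of_nonneg (by linarith [ht.2])] at h1
  exact ⟨h0, h1⟩

lemma IsRTree.hasIntermediatePoints (hT : IsRTree T) : HasIntermediatePoints T := by
  intro x y t ht
  obtain ⟨f, hf0, hf1, hf⟩ := hT.exists_geod x y
  exact ⟨f t, geodesic_mem_seg hf0 hf1 hf ht⟩

/-- Distinct points are joined by an injective path contained in the segment between them. -/
lemma IsRTree.exists_path (hT : IsRTree T) {x y : T} (hxy : x ≠ y) :
    ∃ γ : Path x y, Function.Injective γ ∧ Set.range γ ⊆ seg x y := by
  obtain ⟨f, hf0, hf1, hf⟩ := hT.exists_geod x y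
  obtain ⟨γ, hγ, hγf⟩ := exists_path_of_geodesic hxy hf0 hf1 hf
  refine ⟨γ, hγ, hγf.trans ?_⟩
  rintro _ ⟨t, ht, rfl⟩
  obtain ⟨h0, h1⟩ := geodesic_mem_seg hf0 hf1 hf ht
  rw [mem_seg, h0, h1]; ring

lemma path_trans_injective {x y z : T} {γ : Path x y} {γ' : Path y z}
    (hγ : Function.Injective γ) (hγ' : Function.Injective γ')
    (h : ∀ p ∈ Set.range γ, p ∈ Set.range γ' → p = y) :
    Function.Injective (γ.trans γ') := by
  have key : ∀ s t : unitInterval, (s : ℝ) ≤ 1 / 2 → ¬ (t : ℝ) ≤ 1 / 2 →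
      γ.trans γ' s ≠ γ.trans γ' t := by
    intro s t hs ht hst
    rw [Path.trans_apply, Path.trans_apply, dif_pos hs, dif_neg ht] at hst
    have h2 := h _ ⟨_, rfl⟩ ⟨_, hst.symm⟩
    rw [hst] at h2
    have h3 := hγ' (h2.trans γ'.source.symm)
    have h4 := congrArg Subtype.val h3
    simp only [Set.Icc.coe_zero] at h4
    linarith
  intro s t hst
  by_cases hs : (s : ℝ) ≤ 1 / 2 <;> by_cases ht : (t : ℝ) ≤ 1 / 2
  · rw [Path.trans_apply, Path.trans_apply, dif_pos hs, dif_pos ht] at hst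
    have h4 := congrArg Subtype.val (hγ hst)
    simp only at h4
    exact Subtype.ext (by linarith)
  · exact absurd hst (key s t hs ht)
  · exact absurd hst.symm (key t s ht hs)
  · rw [Path.trans_apply, Path.trans_apply, dif_neg hs, dif_neg ht] at hst
    have h4 := congrArg Subtype.val (hγ' hst)
    simp only at h4
    exact Subtype.ext (by linarith)

/-- If the segments `[x, m]` and `[m, z]` only meet at `m`, then every arc from `x` to `z`
passes through `m`. -/
lemma IsRTree.mem_range_of_inter (hT : IsRTree T) {x m z : T}
    (h : ∀ p ∈ seg x m, p ∈ seg m z → p = m) (γ : Path x z) (hγ : Function.Injective γ) :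
    m ∈ Set.range γ := by
  rcases eq_or_ne x m with rfl | hxm
  · exact ⟨0, γ.source⟩
  rcases eq_or_ne m z with rfl | hmz
  · exact ⟨1, γ.target⟩
  obtain ⟨γ₁, hγ₁, hs₁⟩ := hT.exists_path hxm
  obtain ⟨γ₂, hγ₂, hs₂⟩ := hT.exists_path hmz
  have hinj := path_trans_injective hγ₁ hγ₂ fun p hp hp' => h p (hs₁ hp) (hs₂ hp')
  rw [← hT.arc_unique _ _ _ _ hinj hγ, Path.trans_range]
  exact Or.inl ⟨1, γ₁.target⟩

lemma IsRTree.mem_seg_of_inter (hT : IsRTree T) {x m z : T}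
    (h : ∀ p ∈ seg x m, p ∈ seg m z → p = m) : m ∈ seg x z := by
  rcases eq_or_ne x z with rfl | hxz
  · rw [h x (left_mem_seg _ _) (right_mem_seg _ _)]
    exact left_mem_seg _ _
  · obtain ⟨γ, hγ, hγs⟩ := hT.exists_path hxz
    exact hγs (hT.mem_range_of_inter h γ hγ)

lemma IsRTree.seg_subset_geodesic (hT : IsRTree T) {x y : T} {f : ℝ → T} (hf0 : f 0 = x)
    (hf1 : f (dist x y) = y) (hf : ∀ s ∈ Icc (0 : ℝ) (dist x y), ∀ t ∈ Icc (0 : ℝ) (dist x y),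
      dist (f s) (f t) = |s - t|) : seg x y ⊆ f '' Icc 0 (dist x y) := by
  intro p hp
  rcases eq_or_ne x y with rfl | hxy
  · rw [mem_seg, dist_self, dist_comm p x] at hp
    refine ⟨0, ⟨le_rfl, dist_nonneg⟩, ?_⟩
    rw [hf0]
    exact dist_eq_zero.1 (by linarith)
  · obtain ⟨γ, hγ, hγf⟩ := exists_path_of_geodesic hxy hf0 hf1 hf
    refine hγf (hT.mem_range_of_inter (fun q hq hq' => ?_) γ hγ)
    rw [mem_seg] at hp hq hq'
    have := dist_triangle x q y
    exact dist_eq_zero.1 (by linarith [dist_comm p q, dist_nonneg (x := p) (y := q)])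

lemma continuousOn_geodesic {L : ℝ} {f : ℝ → T} (hf : ∀ s ∈ Icc (0 : ℝ) L,
    ∀ t ∈ Icc (0 : ℝ) L, dist (f s) (f t) = |s - t|) : ContinuousOn f (Icc 0 L) := by
  have : LipschitzOnWith 1 f (Icc 0 L) := LipschitzOnWith.of_dist_le_mul fun s hs t ht => by
    rw [hf s hs t ht, NNReal.coe_one, one_mul, Real.dist_eq]
  exact this.continuousOn

lemma IsRTree.seg_eq_geodesic (hT : IsRTree T) {x y : T} {f : ℝ → T} (hf0 : f 0 = x)
    (hf1 : f (dist x y) = y) (hf : ∀ s ∈ Icc (0 : ℝ) (dist x y), ∀ t ∈ Icc (0 : ℝ) (dist x y),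
      dist (f s) (f t) = |s - t|) : seg x y = f '' Icc 0 (dist x y) := by
  refine (hT.seg_subset_geodesic hf0 hf1 hf).antisymm ?_
  rintro _ ⟨t, ht, rfl⟩
  obtain ⟨h0, h1⟩ := geodesic_mem_seg hf0 hf1 hf ht
  rw [mem_seg, h0, h1]; ring

lemma IsRTree.isCompact_seg (hT : IsRTree T) (x y : T) : IsCompact (seg x y) := by
  obtain ⟨f, hf0, hf1, hf⟩ := hT.exists_geod x y
  rw [hT.seg_eq_geodesic hf0 hf1 hf]
  exact isCompact_Icc.image_of_continuousOn (continuousOn_geodesic hf)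

lemma IsRTree.isPreconnected_seg (hT : IsRTree T) (x y : T) : IsPreconnected (seg x y) := by
  obtain ⟨f, hf0, hf1, hf⟩ := hT.exists_geod x y
  rw [hT.seg_eq_geodesic hf0 hf1 hf]
  exact isPreconnected_Icc.image _ (continuousOn_geodesic hf)

lemma IsRTree.fourPoint (hT : IsRTree T) : FourPoint T := by
  intro x y z w
  obtain ⟨f, hf0, hf1, hf⟩ := hT.exists_geod x y
  have hL0 : (0 : ℝ) ≤ dist x y := dist_nonneg
  have proj : ∀ z : T, ∃ s ∈ Icc (0 : ℝ) (dist x y), dist x z = s + dist (f s) z ∧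
      dist y z = dist x y - s + dist (f s) z := by
    intro z
    obtain ⟨s, hs, hmin⟩ := (hT.isCompact_seg x y).exists_isMinOn ⟨x, left_mem_seg _ _⟩
      (f := fun p => dist p z) (by fun_prop)
    obtain ⟨s, hs', rfl⟩ := hT.seg_subset_geodesic hf0 hf1 hf hs
    obtain ⟨h0, h1⟩ := geodesic_mem_seg hf0 hf1 hf hs'
    have hend : ∀ r : T, seg r (f s) ⊆ seg x y → f s ∈ seg r z := by
      refine fun r hr => hT.mem_seg_of_inter fun p hp hp' => ?_
      have hle : dist (f s) z ≤ dist p z := hmin (hr hp)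
      rw [mem_seg] at hp'
      exact dist_eq_zero.1 (by linarith [dist_comm p (f s), dist_nonneg (x := p) (y := f s)])
    have hx := hend x fun p hp => by
      rw [mem_seg] at hp ⊢
      linarith [dist_triangle p (f s) y, dist_triangle x p y]
    have hy := hend y fun p hp => by
      rw [mem_seg] at hp ⊢
      linarith [dist_triangle x (f s) p, dist_triangle x p y, dist_comm y p, dist_comm y (f s),
        dist_comm p (f s)]
    rw [mem_seg] at hx hy
    exact ⟨s, hs', by linarith, by linarith [dist_comm y (f s)]⟩
  obtain ⟨s, hs, hs1, hs2⟩ := proj z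
  obtain ⟨t, ht, ht1, ht2⟩ := proj w
  have h1 := hf s hs t ht
  have h2 := dist_triangle4 z (f s) (f t) w
  rw [le_max_iff]
  rw [dist_comm z (f s)] at h2
  rcases abs_cases (s - t) with ⟨h3, -⟩ | ⟨h3, -⟩
  · left; linarith
  · right; linarith

end RTrees

section Directions

variable {T : Type*} [MetricSpace T]

lemma IsRTree.connectedComponentIn_eq (hT : IsRTree T) {x y : T} (hyx : y ≠ x) :
    connectedComponentIn {x}ᶜ y = {w | x ∉ seg y w} := by
  ext w
  constructor
  · intro hw hx
    have hy : y ∈ connectedComponentIn {x}ᶜ y := mem_connectedComponentIn hyx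
    exact connectedComponentIn_subset _ _
      (hT.fourPoint.mem_of_isPreconnected isPreconnected_connectedComponentIn hy hw hx) rfl
  · intro hw
    refine (hT.isPreconnected_seg y w).subset_connectedComponentIn (left_mem_seg _ _) ?_
      (right_mem_seg y w)
    rintro p hp rfl
    exact hw hp

lemma IsRTree.isDirection_iff (hT : IsRTree T) {δ : Set T} :
    IsDirection δ ↔ ∃ x y : T, y ≠ x ∧ δ = {w | x ∉ seg y w} := by
  refine exists_congr fun x => exists_congr fun y => and_congr_right fun hyx => ?_
  rw [hT.connectedComponentIn_eq hyx]

lemma FourPoint.treeConvex_setOf_mem_seg (h : FourPoint T) (x y : T) :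
    TreeConvex {w | x ∈ seg y w} := by
  intro a ha c hc z hz
  rw [mem_ofPred_eq, mem_seg] at *
  rcases h.dist_of_mem_seg hz x with h1 | h1 <;>
    linarith [dist_triangle y z a, dist_triangle y z c, dist_triangle y x z,
      dist_comm a z, dist_comm c z]

lemma FourPoint.treeConvex_setOf_notMem_seg (h : FourPoint T) (x y : T) :
    TreeConvex {w | x ∉ seg y w} := by
  intro a ha c hc z hz hx
  rw [mem_ofPred_eq, mem_seg] at *
  rcases h.dist_of_mem_seg hz y with h1 | h1
  · exact ha (le_antisymm (by linarith [dist_triangle x z a, dist_comm a z])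
      (dist_triangle _ _ _))
  · exact hc (le_antisymm (by linarith [dist_triangle x z c, dist_comm c z])
      (dist_triangle _ _ _))

lemma IsDirection.treeConvex_compl (hT : IsRTree T) {δ : Set T} (hδ : IsDirection δ) :
    TreeConvex δᶜ := by
  obtain ⟨x, y, -, rfl⟩ := hT.isDirection_iff.1 hδ
  simpa only [compl_ofPred, not_not] using hT.fourPoint.treeConvex_setOf_mem_seg x y

/-- A half-space: a convex set with convex complement. -/
def IsHalfSpace (A : Set T) : Prop := TreeConvex A ∧ TreeConvex Aᶜ

lemma IsHalfSpace.compl {A : Set T} (hA : IsHalfSpace A) : IsHalfSpace Aᶜ :=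
  ⟨hA.2, by rw [compl_compl]; exact hA.1⟩

lemma FourPoint.le_max_of_mem_seg (h : FourPoint T) (a c : T) {w w' z : T} (hz : z ∈ seg w w') :
    dist z a - dist z c ≤ dist w a - dist w c ∨ dist z a - dist z c ≤ dist w' a - dist w' c := by
  have h1 := dist_triangle w z c
  have h2 := dist_triangle w' z c
  rcases h.dist_of_mem_seg hz a with h | h
  · left; linarith [dist_comm a z, dist_comm a w]
  · right; linarith [dist_comm a z, dist_comm a w']

lemma FourPoint.isHalfSpace_setOf_dist_sub_dist_lt (h : FourPoint T) (a c : T) (k : ℝ) :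
    IsHalfSpace {w | dist w a - dist w c < k} := by
  constructor
  · intro w hw w' hw' z hz
    rw [mem_ofPred_eq] at *
    rcases h.le_max_of_mem_seg a c hz with h | h <;> linarith
  · intro w hw w' hw' z hz
    rw [mem_compl_iff, mem_ofPred_eq, not_lt] at *
    rcases h.le_max_of_mem_seg c a hz with h | h <;> linarith

/-- A strict four point inequality yields a separating half-space. -/
lemma FourPoint.exists_isHalfSpace (h : FourPoint T) {a b c e : T}
    (hlt : dist a b + dist c e < dist a c + dist b e) :
    ∃ A : Set T, IsHalfSpace A ∧ a ∈ A ∧ b ∈ A ∧ c ∉ A ∧ e ∉ A := by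
  have h3 : dist a b + dist c e < dist a e + dist b c := by
    rcases h.cases a c b e with h | h <;> linarith [dist_comm c b]
  refine ⟨_, h.isHalfSpace_setOf_dist_sub_dist_lt a c
    (min (dist c a) (dist e a - dist e c)), ?_, ?_, ?_, ?_⟩
  · have h1 := dist_triangle b a e
    have h2 : dist a c ≠ 0 := by
      intro h0
      rw [dist_eq_zero] at h0
      subst h0
      linarith [dist_self a, dist_comm a b]
    have h4 : 0 < dist a c := lt_of_le_of_ne dist_nonneg h2.symm
    rw [mem_ofPred_eq, dist_self, lt_min_iff]
    constructor <;> linarith [dist_comm a c, dist_comm a b, dist_comm e a, dist_comm e c]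
  · have h1 := dist_triangle a c e
    rw [mem_ofPred_eq, lt_min_iff]
    constructor <;> linarith [dist_comm a c, dist_comm a b, dist_comm e a, dist_comm e c]
  · simp
  · simp

/-- Points separated by a half-space satisfy a strict four point inequality. -/
lemma IsHalfSpace.dist_lt (h : FourPoint T) (hg : HasIntermediatePoints T) {A : Set T}
    (hA : IsHalfSpace A) {a b c e : T} (ha : a ∈ A) (hb : b ∈ A) (hc : c ∉ A) (he : e ∉ A) :
    dist a b + dist c e < dist a c + dist b e := by
  obtain ⟨m, hm1, hm2, hm3⟩ := hg.exists_median h a b c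
  obtain ⟨n, hn1, hn2, hn3⟩ := hg.exists_median h c e a
  have hmA : m ∈ A := hA.1 a ha b hb hm1
  have hnA : n ∉ A := hA.2 c hc e he hn1
  rw [seg_comm] at hn3
  have hlt : dist a m < dist a n := by
    by_contra! hle
    exact hnA (hA.1 a ha m hmA (h.mem_seg_of_dist_le hn3 hm3 hle))
  rw [mem_seg] at *
  have h1 : dist a b + dist c e < dist a e + dist b c := by
    linarith [dist_comm m b, dist_comm n a, dist_comm n e, dist_comm c n, dist_comm a e]
  rcases h.cases a e b c with h | h
  · linarith [dist_comm e c]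
  · linarith [dist_comm e b]

/-- The bridge between two disjoint segments. -/
lemma FourPoint.exists_bridge (h : FourPoint T) (hg : HasIntermediatePoints T) {a b c e : T}
    (hlt : dist a b + dist c e < dist a c + dist b e) :
    ∃ x y, x ≠ y ∧ ∀ z ∈ seg x y, z ∈ seg a c ∧ z ∈ seg a e ∧ z ∈ seg b c ∧ z ∈ seg b e := by
  have h3 : dist a e + dist b c = dist a c + dist b e := by
    rcases h.cases a c b e with h1 | h1 <;> rcases h.cases a e b c with h2 | h2 <;>
      linarith [dist_comm c b, dist_comm e c, dist_comm e b]
  set s := (dist a b + dist a c - dist b c) / 2 with hs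
  set t := (dist a e + dist a c - dist c e) / 2 with ht
  have hst : s < t := by linarith
  have hs0 : 0 ≤ s := by linarith [dist_triangle b a c, dist_comm a b]
  have ht1 : t ≤ dist a c := by linarith [dist_triangle a c e]
  obtain ⟨x, hx1, hx2⟩ := hg a c s ⟨hs0, by linarith⟩
  obtain ⟨y, hy1, hy2⟩ := hg a c t ⟨by linarith, ht1⟩
  have hx : x ∈ seg a c := by rw [mem_seg]; linarith
  have hy : y ∈ seg a c := by rw [mem_seg]; linarith
  refine ⟨x, y, fun hxy => by rw [hxy] at hx1; linarith, fun z hz => ?_⟩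
  have hxy := h.mem_seg_of_dist_le hx hy (by linarith)
  have hzac : z ∈ seg a c := by
    rw [mem_seg] at *
    linarith [dist_triangle a x z, dist_triangle z y c, dist_triangle a z c]
  have hsz : s ≤ dist a z ∧ dist a z ≤ t := by
    rw [mem_seg] at *
    constructor
    · linarith [dist_triangle a z y, dist_nonneg (x := x) (y := z)]
    · linarith [dist_triangle a x z, dist_nonneg (x := z) (y := y)]
  have hb := h.dist_of_mem_seg hzac b
  have he := h.dist_of_mem_seg hzac e
  rw [mem_seg, mem_seg, mem_seg, mem_seg] at *
  have c1 := dist_comm z c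
  have c2 := dist_comm z e
  have c3 := dist_comm b a
  have c4 := dist_comm e a
  have c5 := dist_comm e c
  have hb' : dist b z + dist z c = dist b c := by
    rcases hb with h | h <;> linarith [dist_triangle b z c]
  have he' : dist a z + dist z e = dist a e := by
    rcases he with h | h <;> linarith [dist_triangle a z e]
  exact ⟨hzac, he', hb', by linarith⟩

end Directions

section Refinements

lemma AlignPreserving.isHalfSpace_preimage {T T' : Type*} [MetricSpace T] [MetricSpace T']
    {f : T → T'} (hf : AlignPreserving f) {A : Set T'} (hA : IsHalfSpace A) :
    IsHalfSpace (f ⁻¹' A) :=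
  ⟨fun x hx y hy z hz => hA.1 _ hx _ hy (hf z x y hz),
    fun x hx y hy z hz => hA.2 _ hx _ hy (hf z x y hz)⟩

/-- A nondegenerate segment can be cut into two disjoint directions containing its ends. -/
lemma IsRTree.exists_directions {T : Type*} [MetricSpace T] (hT : IsRTree T) {a b : T}
    (hab : a ≠ b) : ∃ δ δ' : Set T, IsDirection δ ∧ IsDirection δ' ∧ IsHalfSpace δ ∧
      a ∈ δ ∧ b ∈ δ' ∧ Disjoint δ δ' := by
  have hpos : 0 < dist a b := dist_pos.2 hab
  obtain ⟨m, h1, h2⟩ := hT.hasIntermediatePoints a b (dist a b / 2) ⟨by linarith, by linarith⟩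
  have hma : a ≠ m := by rintro rfl; rw [dist_self] at h1; linarith
  have hmb : b ≠ m := by rintro rfl; rw [dist_self] at h2; linarith
  have hself : ∀ c : T, c ≠ m → m ∉ seg c c := fun c hc hm => by
    rw [mem_seg, dist_self, dist_comm m c] at hm
    exact hc (dist_eq_zero.1 (by linarith))
  have hm : m ∈ seg a b := by rw [mem_seg]; linarith
  refine ⟨{w | m ∉ seg a w}, {w | m ∉ seg b w}, hT.isDirection_iff.2 ⟨m, a, hma, rfl⟩,
    hT.isDirection_iff.2 ⟨m, b, hmb, rfl⟩, ⟨hT.fourPoint.treeConvex_setOf_notMem_seg m a, ?_⟩,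
    hself a hma, hself b hmb, Set.disjoint_left.2 fun w hwa hwb => ?_⟩
  · simpa only [compl_ofPred, not_not] using hT.fourPoint.treeConvex_setOf_mem_seg m a
  · rw [mem_ofPred_eq, seg_comm] at hwa hwb
    exact hT.fourPoint.treeConvex_setOf_notMem_seg m w a hwa b hwb hm (right_mem_seg _ _)

/-- The core of two trees with a common refinement contains no nondegenerate rectangle. -/
lemma not_rectangle_subset_core {G T₀ T₁ T₂ : Type*} [Group G] [MetricSpace T₀] [MetricSpace T₁]
    [MetricSpace T₂] [MulAction G T₀] [MulAction G T₁] [MulAction G T₂] (hT₀ : IsRTree T₀)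
    (hT₁ : IsRTree T₁) (hT₂ : IsRTree T₂) [Nonempty T₀] {f₁ : T₀ → T₁} {f₂ : T₀ → T₂}
    (hf₁ : IsRefinementMap G f₁) (hf₂ : IsRefinementMap G f₂) {a₁ b₁ : T₁} {a₂ b₂ : T₂}
    (h₁ : a₁ ≠ b₁) (h₂ : a₂ ≠ b₂) : ¬ (seg a₁ b₁ ×ˢ seg a₂ b₂ ⊆ Core G T₁ T₂) := by
  intro hsub
  obtain ⟨δ, δ', hδ, hδ', hA, ha₁, hb₁, hdisj₁⟩ := hT₁.exists_directions h₁
  obtain ⟨η, η', hη, hη', hB, ha₂, hb₂, hdisj₂⟩ := hT₂.exists_directions h₂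
  obtain ⟨t⟩ := ‹Nonempty T₀›
  have key : ∀ (D : Set T₁) (E : Set T₂) (x : T₁) (y : T₂), IsDirection D → IsDirection E →
      x ∈ D → y ∈ E → x ∈ seg a₁ b₁ → y ∈ seg a₂ b₂ → ∃ u : T₀, f₁ u ∈ D ∧ f₂ u ∈ E := by
    intro D E x y hD hE hx hy hx' hy'
    obtain ⟨γ, hγ, -⟩ := hsub (mk_mem_prod hx' hy') (D ×ˢ E) ⟨D, E, hD, hE, rfl⟩
      (mk_mem_prod hx hy) (f₁ t, f₂ t)
    refine ⟨γ 0 • t, ?_⟩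
    rw [hf₁.2.2.2, hf₂.2.2.2]
    exact hγ 0
  obtain ⟨u₁, h11, h12⟩ := key δ η a₁ a₂ hδ hη ha₁ ha₂ (left_mem_seg _ _) (left_mem_seg _ _)
  obtain ⟨u₂, h21, h22⟩ := key δ η' a₁ b₂ hδ hη' ha₁ hb₂ (left_mem_seg _ _) (right_mem_seg _ _)
  obtain ⟨u₃, h31, h32⟩ := key δ' η b₁ a₂ hδ' hη hb₁ ha₂ (right_mem_seg _ _) (left_mem_seg _ _)
  obtain ⟨u₄, h41, h42⟩ := key δ' η' b₁ b₂ hδ' hη' hb₁ hb₂ (right_mem_seg _ _)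
    (right_mem_seg _ _)
  have hlt₁ := (hf₁.2.2.1.isHalfSpace_preimage hA).dist_lt hT₀.fourPoint
    hT₀.hasIntermediatePoints h11 h21 (hdisj₁.notMem_of_mem_right h31)
    (hdisj₁.notMem_of_mem_right h41)
  have hlt₂ := (hf₂.2.2.1.isHalfSpace_preimage hB).dist_lt hT₀.fourPoint
    hT₀.hasIntermediatePoints h12 h32 (hdisj₂.notMem_of_mem_right h22)
    (hdisj₂.notMem_of_mem_right h42)
  linarith

end Refinements

section Noncrossing

variable {T₁ T₂ : Type*} [MetricSpace T₁] [MetricSpace T₂]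

/-- A subset of a product of two trees is noncrossing if no two splits of its points coming from
the two factors cross. -/
def Noncrossing (M : Set (T₁ × T₂)) : Prop :=
  ∀ a ∈ M, ∀ b ∈ M, ∀ c ∈ M, ∀ e ∈ M,
    ¬ (dist a.1 b.1 + dist c.1 e.1 < dist a.1 c.1 + dist b.1 e.1 ∧
      dist a.2 c.2 + dist b.2 e.2 < dist a.2 b.2 + dist c.2 e.2)

lemma noncrossing_closure {M : Set (T₁ × T₂)} (hM : Noncrossing M) :
    Noncrossing (closure M) := by
  intro a ha b hb c hc e he
  have hcl : IsClosed {q : ((T₁ × T₂) × (T₁ × T₂)) × ((T₁ × T₂) × (T₁ × T₂)) |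
      ¬ (dist q.1.1.1 q.1.2.1 + dist q.2.1.1 q.2.2.1 <
          dist q.1.1.1 q.2.1.1 + dist q.1.2.1 q.2.2.1 ∧
        dist q.1.1.2 q.2.1.2 + dist q.1.2.2 q.2.2.2 <
          dist q.1.1.2 q.1.2.2 + dist q.2.1.2 q.2.2.2)} := by
    simp only [not_and_or, not_lt, ofPred_or]
    exact (isClosed_le (by fun_prop) (by fun_prop)).union
      (isClosed_le (by fun_prop) (by fun_prop))
  have hsub : (M ×ˢ M) ×ˢ (M ×ˢ M) ⊆ _ := fun q hq =>
    hM q.1.1 hq.1.1 q.1.2 hq.1.2 q.2.1 hq.2.1 q.2.2 hq.2.2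
  have hmem : ((a, b), (c, e)) ∈ closure ((M ×ˢ M) ×ˢ (M ×ˢ M)) := by
    rw [closure_prod_eq, closure_prod_eq]
    exact ⟨⟨ha, hb⟩, ⟨hc, he⟩⟩
  exact closure_minimal hsub hcl hmem

lemma exists_quadrants_of_not_noncrossing (h₁ : FourPoint T₁) (h₂ : FourPoint T₂)
    {M : Set (T₁ × T₂)} (hM : ¬ Noncrossing M) :
    ∃ (A : Set T₁) (B : Set T₂), IsHalfSpace A ∧ IsHalfSpace B ∧
      (M ∩ A ×ˢ B).Nonempty ∧ (M ∩ A ×ˢ Bᶜ).Nonempty ∧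
      (M ∩ Aᶜ ×ˢ B).Nonempty ∧ (M ∩ Aᶜ ×ˢ Bᶜ).Nonempty := by
  unfold Noncrossing at hM
  push Not at hM
  obtain ⟨a, ha, b, hb, c, hc, e, he, hlt₁, hlt₂⟩ := hM
  obtain ⟨A, hA, haA, hbA, hcA, heA⟩ := h₁.exists_isHalfSpace hlt₁
  obtain ⟨B, hB, haB, hcB, hbB, heB⟩ := h₂.exists_isHalfSpace hlt₂
  exact ⟨A, B, hA, hB, ⟨a, ha, haA, haB⟩, ⟨b, hb, hbA, hbB⟩, ⟨c, hc, hcA, hcB⟩,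
    ⟨e, he, heA, heB⟩⟩

lemma Noncrossing.false_of_quadrants (hT₁ : IsRTree T₁) (hT₂ : IsRTree T₂)
    {M : Set (T₁ × T₂)} (hM : Noncrossing M) {A : Set T₁} {B : Set T₂} (hA : IsHalfSpace A)
    (hB : IsHalfSpace B) (h₁ : (M ∩ A ×ˢ B).Nonempty) (h₂ : (M ∩ A ×ˢ Bᶜ).Nonempty)
    (h₃ : (M ∩ Aᶜ ×ˢ B).Nonempty) (h₄ : (M ∩ Aᶜ ×ˢ Bᶜ).Nonempty) : False := by
  obtain ⟨a, ha, haA, haB⟩ := h₁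
  obtain ⟨b, hb, hbA, hbB⟩ := h₂
  obtain ⟨c, hc, hcA, hcB⟩ := h₃
  obtain ⟨e, he, heA, heB⟩ := h₄
  exact hM a ha b hb c hc e he
    ⟨hA.dist_lt hT₁.fourPoint hT₁.hasIntermediatePoints haA hbA hcA heA,
      hB.dist_lt hT₂.fourPoint hT₂.hasIntermediatePoints haB hcB hbB heB⟩

/-- To check that an enlargement is noncrossing it suffices to find, in each quadrant it meets
together with the opposite quadrant, a point of the original set. -/
lemma Noncrossing.of_forall_quadrant (hT₁ : IsRTree T₁) (hT₂ : IsRTree T₂)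
    {M N : Set (T₁ × T₂)} (hM : Noncrossing M)
    (h : ∀ (A : Set T₁) (B : Set T₂), IsHalfSpace A → IsHalfSpace B →
      (N ∩ A ×ˢ B).Nonempty → (N ∩ Aᶜ ×ˢ Bᶜ).Nonempty → (M ∩ A ×ˢ B).Nonempty) :
    Noncrossing N := by
  by_contra hN
  obtain ⟨A, B, hA, hB, h1, h2, h3, h4⟩ :=
    exists_quadrants_of_not_noncrossing hT₁.fourPoint hT₂.fourPoint hN
  refine hM.false_of_quadrants hT₁ hT₂ hA hB (h A B hA hB h1 h4) (h A Bᶜ hA hB.compl h2 ?_)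
    (h Aᶜ B hA.compl hB h3 ?_) (h Aᶜ Bᶜ hA.compl hB.compl h4 ?_)
  · rwa [compl_compl]
  · rwa [compl_compl]
  · rwa [compl_compl, compl_compl]

lemma Noncrossing.sUnion {c : Set (Set (T₁ × T₂))} (hc : IsChain (· ⊆ ·) c)
    (h : ∀ M ∈ c, Noncrossing M) : Noncrossing (⋃₀ c) := by
  rintro a ⟨A, hA, ha⟩ b ⟨B, hB, hb⟩ x ⟨X, hX, hx⟩ y ⟨Y, hY, hy⟩
  obtain ⟨U, hU, hAU, hBU⟩ := hc.directedOn A hA B hB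
  obtain ⟨V, hV, hXV, hYV⟩ := hc.directedOn X hX Y hY
  obtain ⟨W, hW, hUW, hVW⟩ := hc.directedOn U hU V hV
  exact h W hW a (hUW (hAU ha)) b (hUW (hBU hb)) x (hVW (hXV hx)) y (hVW (hYV hy))

/-- The product of segments spanned by two points of a product. -/
def segProd (p q : T₁ × T₂) : Set (T₁ × T₂) := seg p.1 q.1 ×ˢ seg p.2 q.2

lemma segProd_comm (p q : T₁ × T₂) : segProd p q = segProd q p := by
  rw [segProd, segProd, seg_comm p.1, seg_comm p.2]

/-- The medians of triples of points of a set. -/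
def medians (M : Set (T₁ × T₂)) : Set (T₁ × T₂) :=
  {m | ∃ a ∈ M, ∃ b ∈ M, ∃ c ∈ M, m ∈ segProd a b ∧ m ∈ segProd b c ∧ m ∈ segProd a c}

lemma subset_medians (M : Set (T₁ × T₂)) : M ⊆ medians M := fun a ha =>
  ⟨a, ha, a, ha, a, ha, ⟨left_mem_seg _ _, left_mem_seg _ _⟩, ⟨left_mem_seg _ _, left_mem_seg _ _⟩,
    ⟨left_mem_seg _ _, left_mem_seg _ _⟩⟩

lemma exists_mem_medians (hT₁ : IsRTree T₁) (hT₂ : IsRTree T₂) {M : Set (T₁ × T₂)}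
    {a b c : T₁ × T₂} (ha : a ∈ M) (hb : b ∈ M) (hc : c ∈ M) :
    ∃ m ∈ medians M, m ∈ segProd a b ∧ m ∈ segProd b c ∧ m ∈ segProd a c := by
  obtain ⟨m₁, h11, h12, h13⟩ := hT₁.hasIntermediatePoints.exists_median hT₁.fourPoint a.1 b.1 c.1
  obtain ⟨m₂, h21, h22, h23⟩ := hT₂.hasIntermediatePoints.exists_median hT₂.fourPoint a.2 b.2 c.2
  exact ⟨(m₁, m₂), ⟨a, ha, b, hb, c, hc, ⟨h11, h21⟩, ⟨h12, h22⟩, ⟨h13, h23⟩⟩, ⟨h11, h21⟩,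
    ⟨h12, h22⟩, ⟨h13, h23⟩⟩

lemma IsHalfSpace.mem_or_mem {T : Type*} [MetricSpace T] {A : Set T} (hA : IsHalfSpace A)
    {a b m : T} (hm : m ∈ seg a b) (hmA : m ∈ A) : a ∈ A ∨ b ∈ A := by
  by_contra! h
  exact hA.2 a h.1 b h.2 hm hmA

lemma noncrossing_medians (hT₁ : IsRTree T₁) (hT₂ : IsRTree T₂) {M : Set (T₁ × T₂)}
    (hM : Noncrossing M) : Noncrossing (medians M) := by
  refine hM.of_forall_quadrant hT₁ hT₂ fun A B hA hB h _ => ?_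
  obtain ⟨m, ⟨a, ha, b, hb, c, hc, h1, h2, h3⟩, hmA, hmB⟩ := h
  have a1 := hA.mem_or_mem h1.1 hmA
  have a2 := hA.mem_or_mem h2.1 hmA
  have a3 := hA.mem_or_mem h3.1 hmA
  have b1 := hB.mem_or_mem h1.2 hmB
  have b2 := hB.mem_or_mem h2.2 hmB
  have b3 := hB.mem_or_mem h3.2 hmB
  have : (a.1 ∈ A ∧ a.2 ∈ B) ∨ (b.1 ∈ A ∧ b.2 ∈ B) ∨ (c.1 ∈ A ∧ c.2 ∈ B) := by tauto
  rcases this with h | h | h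
  exacts [⟨a, ha, h⟩, ⟨b, hb, h⟩, ⟨c, hc, h⟩]

/-- Two points of `M` form a gap if there is no other point of `M` between them. -/
def IsGap (M : Set (T₁ × T₂)) (p q : T₁ × T₂) : Prop :=
  p ∈ M ∧ q ∈ M ∧ ∀ w ∈ M, w ∈ segProd p q → w = p ∨ w = q

lemma IsGap.symm {M : Set (T₁ × T₂)} {p q : T₁ × T₂} (h : IsGap M p q) : IsGap M q p :=
  ⟨h.2.1, h.1, fun w hw hwqp => (h.2.2 w hw (segProd_comm q p ▸ hwqp)).symm⟩

/-- In a set closed under medians, gaps have no side branches. -/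
lemma IsGap.mem_segProd (hT₁ : IsRTree T₁) (hT₂ : IsRTree T₂) {M : Set (T₁ × T₂)}
    (hM : medians M ⊆ M) {p q w : T₁ × T₂} (h : IsGap M p q) (hw : w ∈ M) :
    p ∈ segProd q w ∨ q ∈ segProd p w := by
  obtain ⟨m, hm, h1, h2, h3⟩ := exists_mem_medians hT₁ hT₂ h.1 h.2.1 hw
  rcases h.2.2 m (hM hm) h1 with rfl | rfl
  exacts [Or.inl h2, Or.inr h3]

/-- `m` is the midpoint of `x` and `y`. -/
def IsMidpoint {T : Type*} [MetricSpace T] (x y m : T) : Prop :=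
  dist x m = dist x y / 2 ∧ dist m y = dist x y / 2

lemma IsMidpoint.mem_seg {T : Type*} [MetricSpace T] {x y m : T} (h : IsMidpoint x y m) :
    m ∈ seg x y := by
  rw [Guirardel.mem_seg, h.1, h.2, add_halves]

lemma IsMidpoint.symm {T : Type*} [MetricSpace T] {x y m : T} (h : IsMidpoint x y m) :
    IsMidpoint y x m := by
  rw [IsMidpoint, dist_comm y m, dist_comm m x, dist_comm y x]
  exact ⟨h.2, h.1⟩

lemma IsMidpoint.eq_of_eq_or_eq {T : Type*} [MetricSpace T] {x y m : T} (h : IsMidpoint x y m)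
    (hm : m = x ∨ m = y) : x = y := by
  rcases hm with rfl | rfl
  · exact dist_eq_zero.1 (by linarith [h.1, dist_self m])
  · exact dist_eq_zero.1 (by linarith [h.2, dist_self m])

lemma IsRTree.exists_isMidpoint {T : Type*} [MetricSpace T] (hT : IsRTree T) (x y : T) :
    ∃ m, IsMidpoint x y m := by
  obtain ⟨m, h, h'⟩ := hT.hasIntermediatePoints x y (dist x y / 2)
    ⟨by positivity, half_le_self dist_nonneg⟩
  exact ⟨m, h, h'.trans (sub_half _)⟩

/-- Two segments, each of whose endpoints projects to the corresponding endpoint of the other,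
are disjoint, equal or degenerate. -/
lemma FourPoint.eq_of_mem_seg_of_mem_seg {T : Type*} [MetricSpace T] (h : FourPoint T)
    {p q p' q' : T} (hpq : p ≠ q) (h1 : p ∈ seg q p') (h2 : q ∈ seg p q') (h3 : p' ∈ seg q' p)
    (h4 : q' ∈ seg p' q) : p = p' ∧ q = q' := by
  have hpos : 0 < dist p q := dist_pos.2 hpq
  have c1 := dist_comm p q
  have c2 := dist_comm p' q'
  have c3 := dist_comm p p'
  have c4 := dist_comm q q'
  have c5 := dist_comm p q'
  have c6 := dist_comm q p'
  have := dist_nonneg (x := p) (y := p')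
  have := dist_nonneg (x := q) (y := q')
  rw [mem_seg] at *
  constructor <;> refine dist_eq_zero.1 ?_ <;> rcases h.cases p q' q p' with h | h <;> linarith

/-- The midpoints of the gaps of `M`. -/
def gapMidpoints (M : Set (T₁ × T₂)) : Set (T₁ × T₂) :=
  {z | ∃ p q, IsGap M p q ∧ IsMidpoint p.1 q.1 z.1 ∧ IsMidpoint p.2 q.2 z.2}

lemma subset_gapMidpoints (M : Set (T₁ × T₂)) : M ⊆ gapMidpoints M := fun a ha =>
  ⟨a, a, ⟨ha, ha, fun w _ hw => Or.inl <| Prod.ext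
    (dist_eq_zero.1 (by have := hw.1; rw [mem_seg, dist_self, dist_comm] at this; linarith))
    (dist_eq_zero.1 (by have := hw.2; rw [mem_seg, dist_self, dist_comm] at this; linarith))⟩,
    by simp [IsMidpoint], by simp [IsMidpoint]⟩

/-- If the midpoint of a gap lies in a quadrant not meeting `M`, then the endpoints of the gap
lie in the two adjacent quadrants. -/
lemma exists_gap_of_disjoint_quadrant {M : Set (T₁ × T₂)} {A : Set T₁} {B : Set T₂}
    (hA : IsHalfSpace A) (hB : IsHalfSpace B) (hM : ¬ (M ∩ A ×ˢ B).Nonempty) {z : T₁ × T₂}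
    (hz : z ∈ gapMidpoints M) (hzA : z.1 ∈ A) (hzB : z.2 ∈ B) :
    ∃ p q, IsGap M p q ∧ IsMidpoint p.1 q.1 z.1 ∧ p.1 ∈ A ∧ p.2 ∉ B ∧ q.1 ∉ A ∧ q.2 ∈ B := by
  obtain ⟨p, q, hpq, hm₁, hm₂⟩ := hz
  have hp : ¬ (p.1 ∈ A ∧ p.2 ∈ B) := fun h => hM ⟨p, hpq.1, h⟩
  have hq : ¬ (q.1 ∈ A ∧ q.2 ∈ B) := fun h => hM ⟨q, hpq.2.1, h⟩
  have hA' := hA.mem_or_mem hm₁.mem_seg hzA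
  have hB' := hB.mem_or_mem hm₂.mem_seg hzB
  by_cases hpA : p.1 ∈ A
  · exact ⟨p, q, hpq, hm₁, by tauto⟩
  · exact ⟨q, p, hpq.symm, hm₁.symm, by tauto⟩

lemma noncrossing_gapMidpoints (hT₁ : IsRTree T₁) (hT₂ : IsRTree T₂) {M : Set (T₁ × T₂)}
    (hM : Noncrossing M) (hmed : medians M ⊆ M) : Noncrossing (gapMidpoints M) := by
  refine hM.of_forall_quadrant hT₁ hT₂ ?_
  rintro A B hA hB ⟨z, hz, hzA, hzB⟩ ⟨z', hz', hzA', hzB'⟩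
  by_contra hAB
  obtain ⟨p, q, hpq, hm, hpA, hpB, hqA, hqB⟩ :=
    exists_gap_of_disjoint_quadrant hA hB hAB hz hzA hzB
  by_cases hAB' : (M ∩ Aᶜ ×ˢ Bᶜ).Nonempty
  · obtain ⟨w, hw, hwA, hwB⟩ := hAB'
    rcases hpq.mem_segProd hT₁ hT₂ hmed hw with h | h
    · exact hA.2 _ hqA _ hwA h.1 hpA
    · exact hB.2 _ hpB _ hwB h.2 hqB
  · obtain ⟨q', p', hpq', hm', hqA', hqB', hpA', hpB'⟩ :=
      exists_gap_of_disjoint_quadrant hA.compl hB.compl hAB' hz' hzA' hzB'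
    rw [mem_compl_iff, not_not] at hqB' hpA'
    have key : ∀ {p q p' q' : T₁ × T₂}, IsGap M p q → IsGap M p' q' → p.1 ∈ A → q.1 ∉ A →
        p'.1 ∈ A → q'.1 ∉ A → p.1 ∈ seg q.1 p'.1 ∧ q.1 ∈ seg p.1 q'.1 := by
      intro p q p' q' hpq hpq' hp hq hp' hq'
      constructor
      · refine ((hpq.mem_segProd hT₁ hT₂ hmed hpq'.1).resolve_right fun h => hq ?_).1
        exact hA.1 _ hp _ hp' h.1
      · refine ((hpq.mem_segProd hT₁ hT₂ hmed hpq'.2.1).resolve_left fun h => ?_).1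
        exact hA.2 _ hq _ hq' h.1 hp
    obtain ⟨k1, k2⟩ := key hpq hpq'.symm hpA hqA hpA' hqA'
    obtain ⟨k3, k4⟩ := key hpq'.symm hpq hpA' hqA' hpA hqA
    obtain ⟨e1, e2⟩ := hT₁.fourPoint.eq_of_mem_seg_of_mem_seg
      (fun h : p.1 = q.1 => hqA (h ▸ hpA)) k1 k2 k3 k4
    have hm'' := hm'.symm
    rw [← e1, ← e2] at hm''
    have := hT₁.fourPoint.eq_of_mem_seg hm.mem_seg hm''.mem_seg (hm.1.trans hm''.1.symm)
    exact hzA' (this ▸ hzA)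

lemma IsDirection.mem_or_mem {T : Type*} [MetricSpace T] (hT : IsRTree T) {δ : Set T}
    (hδ : IsDirection δ) {a b m : T} (hm : m ∈ seg a b) (hmδ : m ∈ δ) : a ∈ δ ∨ b ∈ δ := by
  by_contra! h
  exact hδ.treeConvex_compl hT a h.1 b h.2 hm hmδ

/-- If the core contains no nondegenerate rectangle, then it is noncrossing. -/
lemma noncrossing_core {G : Type*} [Group G] [MulAction G T₁] [MulAction G T₂]
    (hT₁ : IsRTree T₁) (hT₂ : IsRTree T₂)
    (h : ∀ (a₁ b₁ : T₁) (a₂ b₂ : T₂), a₁ ≠ b₁ → a₂ ≠ b₂ →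
      ¬ (seg a₁ b₁ ×ˢ seg a₂ b₂ ⊆ Core G T₁ T₂)) : Noncrossing (Core G T₁ T₂) := by
  rintro a ha b hb c hc e he ⟨hlt₁, hlt₂⟩
  obtain ⟨x₁, y₁, hxy₁, hz₁⟩ := hT₁.fourPoint.exists_bridge hT₁.hasIntermediatePoints hlt₁
  obtain ⟨x₂, y₂, hxy₂, hz₂⟩ := hT₂.fourPoint.exists_bridge hT₂.hasIntermediatePoints hlt₂
  refine h x₁ y₁ x₂ y₂ hxy₁ hxy₂ ?_
  rintro z ⟨hz1, hz2⟩ _ ⟨δ, η, hδ, hη, rfl⟩ ⟨hzδ, hzη⟩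
  obtain ⟨p1, p2, p3, p4⟩ := hz₁ _ hz1
  obtain ⟨q1, q2, q3, q4⟩ := hz₂ _ hz2
  have hab : (a.1 ∈ δ ∧ b.1 ∈ δ) ∨ (c.1 ∈ δ ∧ e.1 ∈ δ) := by
    have a1 := hδ.mem_or_mem hT₁ p1 hzδ
    have a2 := hδ.mem_or_mem hT₁ p2 hzδ
    have a3 := hδ.mem_or_mem hT₁ p3 hzδ
    have a4 := hδ.mem_or_mem hT₁ p4 hzδ
    tauto
  have hac : (a.2 ∈ η ∧ c.2 ∈ η) ∨ (b.2 ∈ η ∧ e.2 ∈ η) := by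
    have b1 := hη.mem_or_mem hT₂ q1 hzη
    have b2 := hη.mem_or_mem hT₂ q2 hzη
    have b3 := hη.mem_or_mem hT₂ q3 hzη
    have b4 := hη.mem_or_mem hT₂ q4 hzη
    tauto
  have hQ : IsQuadrant (δ ×ˢ η) := ⟨δ, η, hδ, hη, rfl⟩
  rcases hab with ⟨h1, h2⟩ | ⟨h1, h2⟩ <;> rcases hac with ⟨h3, h4⟩ | ⟨h3, h4⟩
  exacts [ha _ hQ ⟨h1, h3⟩, hb _ hQ ⟨h2, h3⟩, hc _ hQ ⟨h1, h4⟩, he _ hQ ⟨h2, h4⟩]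

end Noncrossing

section Invariance

variable {G T T₁ T₂ : Type*} [Group G] [MetricSpace T] [MetricSpace T₁] [MetricSpace T₂]
  [MulAction G T] [MulAction G T₁] [MulAction G T₂]

lemma IsometricAction.smul_mem_seg (hiso : IsometricAction G T) (g : G) {x y p : T} :
    g • p ∈ seg (g • x) (g • y) ↔ p ∈ seg x y := by
  rw [mem_seg, mem_seg, hiso, hiso, hiso]

lemma IsometricAction.continuous_smul (hiso : IsometricAction G T) (g : G) :
    Continuous fun x : T => g • x :=
  (Isometry.of_dist_eq fun x y => hiso g x y).continuous

lemma IsDirection.preimage_smul (hT : IsRTree T) (hiso : IsometricAction G T) {δ : Set T}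
    (hδ : IsDirection δ) (g : G) : IsDirection {w : T | g • w ∈ δ} := by
  obtain ⟨x, y, hyx, rfl⟩ := hT.isDirection_iff.1 hδ
  refine hT.isDirection_iff.2 ⟨g⁻¹ • x, g⁻¹ • y, fun h => hyx (smul_left_cancel _ h), ?_⟩
  ext w
  rw [mem_ofPred_eq, mem_ofPred_eq, mem_ofPred_eq, ← hiso.smul_mem_seg g (x := g⁻¹ • y),
    smul_inv_smul, smul_inv_smul]

lemma IsometricAction.tendsto_dist_mul_smul (hiso : IsometricAction G T) (g : G) {γ : ℕ → G}
    {p : T} (h : Tendsto (fun k => dist (γ k • p) p) atTop atTop) :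
    Tendsto (fun k => dist ((g * γ k) • p) p) atTop atTop := by
  refine tendsto_atTop_mono (fun k => ?_) (tendsto_atTop_add_const_right _ (-dist (g • p) p) h)
  have h1 := dist_triangle (g • γ k • p) p (g • p)
  rw [hiso, dist_comm p] at h1
  rw [mul_smul]
  linarith

lemma smul_mem_core (hT₁ : IsRTree T₁) (hT₂ : IsRTree T₂) (hiso₁ : IsometricAction G T₁)
    (hiso₂ : IsometricAction G T₂) (g : G) {z : T₁ × T₂} (hz : z ∈ Core G T₁ T₂) :
    g • z ∈ Core G T₁ T₂ := by
  rintro _ ⟨δ, η, hδ, hη, rfl⟩ hgz p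
  obtain ⟨γ, hγ, h₁, h₂⟩ := hz _ ⟨_, _, hδ.preimage_smul hT₁ hiso₁ g,
    hη.preimage_smul hT₂ hiso₂ g, rfl⟩ hgz p
  refine ⟨fun k => g * γ k, fun k => ?_, hiso₁.tendsto_dist_mul_smul g h₁,
    hiso₂.tendsto_dist_mul_smul g h₂⟩
  rw [mul_smul, mul_smul]
  exact hγ k

lemma smul_mem_segProd (hiso₁ : IsometricAction G T₁) (hiso₂ : IsometricAction G T₂) (g : G)
    {p q z : T₁ × T₂} : g • z ∈ segProd (g • p) (g • q) ↔ z ∈ segProd p q :=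
  and_congr (hiso₁.smul_mem_seg g) (hiso₂.smul_mem_seg g)

/-- A set is invariant if it is stable under the action of every group element. -/
def Invariant (G : Type*) {X : Type*} [SMul G X] (M : Set X) : Prop :=
  ∀ (g : G), ∀ z ∈ M, g • z ∈ M

variable {M : Set (T₁ × T₂)}

lemma Invariant.closure (hM : Invariant G M) (hiso₁ : IsometricAction G T₁)
    (hiso₂ : IsometricAction G T₂) : Invariant G (closure M) := fun g _ hz =>
  map_mem_closure (f := fun w : T₁ × T₂ => g • w)
    (((hiso₁.continuous_smul g).comp continuous_fst).prodMk
      ((hiso₂.continuous_smul g).comp continuous_snd)) hz (hM g)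

lemma Invariant.medians (hM : Invariant G M) (hiso₁ : IsometricAction G T₁)
    (hiso₂ : IsometricAction G T₂) : Invariant G (medians M) := by
  rintro g z ⟨a, ha, b, hb, c, hc, h1, h2, h3⟩
  exact ⟨_, hM g a ha, _, hM g b hb, _, hM g c hc, (smul_mem_segProd hiso₁ hiso₂ g).2 h1,
    (smul_mem_segProd hiso₁ hiso₂ g).2 h2, (smul_mem_segProd hiso₁ hiso₂ g).2 h3⟩

lemma IsGap.smul (hM : Invariant G M) (hiso₁ : IsometricAction G T₁)
    (hiso₂ : IsometricAction G T₂) (g : G) {p q : T₁ × T₂} (h : IsGap M p q) :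
    IsGap M (g • p) (g • q) := by
  refine ⟨hM g p h.1, hM g q h.2.1, fun w hw hwpq => ?_⟩
  rw [← smul_inv_smul g w, smul_mem_segProd hiso₁ hiso₂] at hwpq
  exact (h.2.2 _ (hM g⁻¹ w hw) hwpq).imp inv_smul_eq_iff.1 inv_smul_eq_iff.1

lemma IsometricAction.isMidpoint_smul (hiso : IsometricAction G T) (g : G) {x y m : T}
    (h : IsMidpoint x y m) : IsMidpoint (g • x) (g • y) (g • m) := by
  rwa [IsMidpoint, hiso, hiso, hiso]

lemma Invariant.gapMidpoints (hM : Invariant G M) (hiso₁ : IsometricAction G T₁)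
    (hiso₂ : IsometricAction G T₂) : Invariant G (gapMidpoints M) := by
  rintro g z ⟨p, q, hpq, h1, h2⟩
  exact ⟨_, _, hpq.smul hM hiso₁ hiso₂ g, hiso₁.isMidpoint_smul g h1, hiso₂.isMidpoint_smul g h2⟩

/-- An invariant noncrossing set is contained in a closed invariant noncrossing set without
gaps. -/
lemma exists_noncrossing_without_gaps (hT₁ : IsRTree T₁) (hT₂ : IsRTree T₂)
    (hiso₁ : IsometricAction G T₁) (hiso₂ : IsometricAction G T₂) {C : Set (T₁ × T₂)}
    (hC : Noncrossing C) (hCinv : Invariant G C) :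
    ∃ M, C ⊆ M ∧ Noncrossing M ∧ Invariant G M ∧ IsClosed M ∧ ∀ p q, IsGap M p q → p = q := by
  obtain ⟨M, hCM, hmax⟩ := zorn_subset_nonempty
    {M : Set (T₁ × T₂) | Noncrossing M ∧ Invariant G M}
    (fun c hc hchain _ => ⟨⋃₀ c, ⟨.sUnion hchain fun M hM => (hc hM).1,
      fun g z ⟨M, hM, hz⟩ => ⟨M, hM, (hc hM).2 g z hz⟩⟩, fun M hM => subset_sUnion_of_mem hM⟩)
    C ⟨hC, hCinv⟩
  obtain ⟨hM, hMinv⟩ := hmax.prop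
  have hcl : closure M ⊆ M := hmax.le_of_ge
    ⟨noncrossing_closure hM, hMinv.closure hiso₁ hiso₂⟩ subset_closure
  have hmed : medians M ⊆ M := hmax.le_of_ge
    ⟨noncrossing_medians hT₁ hT₂ hM, hMinv.medians hiso₁ hiso₂⟩ (subset_medians M)
  have hmid : gapMidpoints M ⊆ M := hmax.le_of_ge
    ⟨noncrossing_gapMidpoints hT₁ hT₂ hM hmed, hMinv.gapMidpoints hiso₁ hiso₂⟩
    (subset_gapMidpoints M)
  refine ⟨M, hCM, hM, hMinv, isClosed_of_closure_subset hcl, fun p q hpq => ?_⟩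
  obtain ⟨m₁, h₁⟩ := hT₁.exists_isMidpoint p.1 q.1
  obtain ⟨m₂, h₂⟩ := hT₂.exists_isMidpoint p.2 q.2
  have := hpq.2.2 (m₁, m₂) (hmid ⟨p, q, hpq, h₁, h₂⟩) ⟨h₁.mem_seg, h₂.mem_seg⟩
  exact Prod.ext (h₁.eq_of_eq_or_eq (this.imp (congrArg Prod.fst) (congrArg Prod.fst)))
    (h₂.eq_of_eq_or_eq (this.imp (congrArg Prod.snd) (congrArg Prod.snd)))

end Invariance

section EllOne

variable {T₁ T₂ : Type*} [MetricSpace T₁] [MetricSpace T₂]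

/-- A subset of a product, with the restriction of the `ℓ¹` metric. -/
@[ext]
structure EllOne (M : Set (T₁ × T₂)) where
  /-- The underlying point of the product. -/
  val : T₁ × T₂
  mem : val ∈ M

variable {M : Set (T₁ × T₂)}

instance : MetricSpace (EllOne M) where
  dist u v := dist u.val.1 v.val.1 + dist u.val.2 v.val.2
  dist_self u := by simp
  dist_comm u v := by simp only [dist_comm]
  dist_triangle u v w := by
    have h1 := dist_triangle u.val.1 v.val.1 w.val.1
    have h2 := dist_triangle u.val.2 v.val.2 w.val.2
    change _ + _ ≤ _ + _ + (_ + _)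
    linarith
  eq_of_dist_eq_zero := by
    intro u v h
    change _ + _ = _ at h
    have h1 := dist_nonneg (x := u.val.1) (y := v.val.1)
    have h2 := dist_nonneg (x := u.val.2) (y := v.val.2)
    exact EllOne.ext (Prod.ext (dist_eq_zero.1 (by linarith)) (dist_eq_zero.1 (by linarith)))

lemma EllOne.dist_def (u v : EllOne M) :
    dist u v = dist u.val.1 v.val.1 + dist u.val.2 v.val.2 := rfl

lemma EllOne.mem_seg_iff {u v w : EllOne M} :
    w ∈ seg u v ↔ w.val ∈ segProd u.val v.val := by
  have h1 := dist_triangle u.val.1 w.val.1 v.val.1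
  have h2 := dist_triangle u.val.2 w.val.2 v.val.2
  rw [segProd, mem_prod, mem_seg, mem_seg, mem_seg, dist_def, dist_def, dist_def]
  constructor
  · intro h
    constructor <;> linarith
  · rintro ⟨h, h'⟩
    linarith

lemma Noncrossing.fourPoint_ellOne (h₁ : FourPoint T₁) (h₂ : FourPoint T₂)
    (hM : Noncrossing M) : FourPoint (EllOne M) := by
  intro a b c e
  have n1 := hM a.val a.mem c.val c.mem e.val e.mem b.val b.mem
  have n2 := hM a.val a.mem e.val e.mem c.val c.mem b.val b.mem
  have p1 := h₁.cases a.val.1 b.val.1 c.val.1 e.val.1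
  have p2 := h₂.cases a.val.2 b.val.2 c.val.2 e.val.2
  rw [dist_comm e.val.1 b.val.1, dist_comm e.val.2 b.val.2, dist_comm c.val.1 b.val.1,
    dist_comm c.val.2 b.val.2, not_and_or, not_lt, not_lt] at n1 n2
  rw [le_max_iff]
  by_contra! h
  simp only [EllOne.dist_def] at h
  rcases p1 with p1 | p1 <;> rcases p2 with p2 | p2 <;> rcases n1 with n1 | n1 <;>
    rcases n2 with n2 | n2 <;> linarith

lemma Noncrossing.hasIntermediatePoints_ellOne (hT₁ : IsRTree T₁) (hT₂ : IsRTree T₂)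
    (hM : Noncrossing M) (hcl : IsClosed M) (hgap : ∀ p q, IsGap M p q → p = q) :
    HasIntermediatePoints (EllOne M) := by
  intro g h t ht
  have h4 := hM.fourPoint_ellOne hT₁.fourPoint hT₂.fourPoint
  have hK : IsCompact (M ∩ segProd g.val h.val) :=
    ((hT₁.isCompact_seg _ _).prod (hT₂.isCompact_seg _ _)).inter_left hcl
  have hτ : Continuous fun w : T₁ × T₂ => dist g.val.1 w.1 + dist g.val.2 w.2 := by fun_prop
  have hKle : IsCompact (M ∩ segProd g.val h.val ∩ {w | dist g.val.1 w.1 + dist g.val.2 w.2 ≤ t}) :=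
    hK.inter_right (isClosed_le hτ continuous_const)
  have hKge : IsCompact (M ∩ segProd g.val h.val ∩ {w | t ≤ dist g.val.1 w.1 + dist g.val.2 w.2}) :=
    hK.inter_right (isClosed_le continuous_const hτ)
  obtain ⟨p, ⟨⟨hpM, hp⟩, hpt⟩, hpmax⟩ := hKle.exists_isMaxOn
    ⟨g.val, ⟨g.mem, left_mem_seg _ _, left_mem_seg _ _⟩, by simpa using ht.1⟩ hτ.continuousOn
  obtain ⟨q, ⟨⟨hqM, hq⟩, hqt⟩, hqmin⟩ := hKge.exists_isMinOn
    ⟨h.val, ⟨h.mem, right_mem_seg _ _, right_mem_seg _ _⟩, ht.2⟩ hτ.continuousOn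
  obtain ⟨P, rfl⟩ : ∃ P : EllOne M, P.val = p := ⟨⟨p, hpM⟩, rfl⟩
  obtain ⟨Q, rfl⟩ : ∃ Q : EllOne M, Q.val = q := ⟨⟨q, hqM⟩, rfl⟩
  have hPt : dist g P ≤ t := hpt
  have hQt : t ≤ dist g Q := hqt
  have hPQ := h4.mem_seg_of_dist_le (EllOne.mem_seg_iff.2 hp) (EllOne.mem_seg_iff.2 hq)
    (hPt.trans hQt)
  replace hp := EllOne.mem_seg_iff.2 hp
  replace hq := EllOne.mem_seg_iff.2 hq
  rw [mem_seg] at hp hq hPQ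
  have hgapPQ : IsGap M P.val Q.val := by
    refine ⟨P.mem, Q.mem, fun w hwM hw => ?_⟩
    obtain ⟨W, rfl⟩ : ∃ W : EllOne M, W.val = w := ⟨⟨w, hwM⟩, rfl⟩
    replace hw := EllOne.mem_seg_iff.2 hw
    rw [mem_seg] at hw
    have t1 := dist_triangle g P W
    have t2 := dist_triangle W Q h
    have t3 := dist_triangle g W h
    have t4 := dist_nonneg (x := P) (y := W)
    have t5 := dist_nonneg (x := W) (y := Q)
    have hWK : W.val ∈ M ∩ segProd g.val h.val :=
      ⟨W.mem, EllOne.mem_seg_iff.1 (by rw [mem_seg]; linarith)⟩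
    rcases le_total (dist g W) t with hWt | hWt
    · have hle : dist g W ≤ dist g P := hpmax ⟨hWK, hWt⟩
      exact .inl (congrArg EllOne.val (dist_eq_zero.1 (by linarith : dist P W = 0)).symm)
    · have hle : dist g Q ≤ dist g W := hqmin ⟨hWK, hWt⟩
      exact .inr (congrArg EllOne.val (dist_eq_zero.1 (by linarith : dist W Q = 0)))
  obtain rfl : P = Q := EllOne.ext (hgap _ _ hgapPQ)
  have hPt' := hPt.antisymm hQt
  exact ⟨P, hPt', by linarith⟩

lemma continuous_val_fst : Continuous fun u : EllOne M => u.val.1 :=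
  (LipschitzWith.of_dist_le_mul (K := 1) fun u v => by
    rw [NNReal.coe_one, one_mul, EllOne.dist_def]
    exact le_add_of_nonneg_right dist_nonneg).continuous

lemma continuous_val_snd : Continuous fun u : EllOne M => u.val.2 :=
  (LipschitzWith.of_dist_le_mul (K := 1) fun u v => by
    rw [NNReal.coe_one, one_mul, EllOne.dist_def]
    exact le_add_of_nonneg_left dist_nonneg).continuous

/-- A continuous map of trees has convex image. -/
lemma IsRTree.treeConvex_range {T T' : Type*} [MetricSpace T] [MetricSpace T']
    (hT : IsRTree T) (hT' : FourPoint T') {f : T → T'} (hc : Continuous f) :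
    TreeConvex (range f) := by
  rintro _ ⟨u, rfl⟩ _ ⟨v, rfl⟩ x hx
  exact image_subset_range f (seg u v) (hT'.mem_of_isPreconnected
    ((hT.isPreconnected_seg u v).image f hc.continuousOn)
    (mem_image_of_mem f (left_mem_seg u v)) (mem_image_of_mem f (right_mem_seg u v)) hx)

lemma isRefinementMap_of_alignPreserving {G T T' : Type*} [Group G] [MetricSpace T]
    [MetricSpace T'] [MulAction G T] [MulAction G T'] [Nonempty T] (hT : IsRTree T)
    (hT' : IsRTree T') (hmin : MinimalAction G T') {f : T → T'} (hc : Continuous f)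
    (hf : AlignPreserving f) (hequiv : ∀ (g : G) (x : T), f (g • x) = g • f x) :
    IsRefinementMap G f := by
  refine ⟨hc, range_eq_univ.1 (hmin _ (range_nonempty f)
    (hT.treeConvex_range hT'.fourPoint hc) ?_), hf, hequiv⟩
  rintro g _ ⟨x, rfl⟩
  exact ⟨g • x, hequiv g x⟩

/-- The action of `G` on an invariant set. -/
abbrev Invariant.mulAction {G : Type*} [Group G] [MulAction G T₁] [MulAction G T₂]
    (hM : Invariant G M) : MulAction G (EllOne M) where
  smul g u := ⟨g • u.val, hM g _ u.mem⟩
  one_smul u := EllOne.ext (one_smul G u.val)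
  mul_smul g h u := EllOne.ext (mul_smul g h u.val)

/-- Two minimal actions whose product contains a nonempty invariant noncrossing set have a common
refinement. -/
lemma exists_common_refinement {G T₁ T₂ : Type} [Group G] [MetricSpace T₁] [MetricSpace T₂]
    [MulAction G T₁] [MulAction G T₂] (hT₁ : IsRTree T₁) (hT₂ : IsRTree T₂)
    (hiso₁ : IsometricAction G T₁) (hiso₂ : IsometricAction G T₂) (hmin₁ : MinimalAction G T₁)
    (hmin₂ : MinimalAction G T₂) {C : Set (T₁ × T₂)} (hne : C.Nonempty) (hC : Noncrossing C)
    (hCinv : Invariant G C) :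
    ∃ (T₀ : GTree G) (f₁ : T₀.carrier → T₁) (f₂ : T₀.carrier → T₂),
      IsRefinementMap G f₁ ∧ IsRefinementMap G f₂ := by
  obtain ⟨M, hCM, hM, hinv, hcl, hgap⟩ :=
    exists_noncrossing_without_gaps hT₁ hT₂ hiso₁ hiso₂ hC hCinv
  let := hinv.mulAction
  have hT₀ : IsRTree (EllOne M) := (hM.fourPoint_ellOne hT₁.fourPoint hT₂.fourPoint).isRTree
    (hM.hasIntermediatePoints_ellOne hT₁ hT₂ hcl hgap)
  have : Nonempty (EllOne M) := hne.elim fun z hz => ⟨⟨z, hCM hz⟩⟩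
  exact ⟨⟨EllOne M, fun g u v => congrArg₂ (· + ·) (hiso₁ g _ _) (hiso₂ g _ _), hT₀⟩,
    fun u => u.val.1, fun u => u.val.2,
    isRefinementMap_of_alignPreserving hT₀ hT₁ hmin₁ continuous_val_fst
      (fun _ _ _ h => (EllOne.mem_seg_iff.1 h).1) fun _ _ => rfl,
    isRefinementMap_of_alignPreserving hT₀ hT₂ hmin₂ continuous_val_snd
      (fun _ _ _ h => (EllOne.mem_seg_iff.1 h).2) fun _ _ => rfl⟩

end EllOne

/-- Theorem 7.1: two minimal actions with non-empty core have a common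
refinement iff the core is 1-dimensional, i.e. contains no non-degenerate rectangle. -/
theorem common_refinement_iff_core_one_dimensional
    {G : Type} {T₁ T₂ : Type} [Group G] [MetricSpace T₁] [MetricSpace T₂]
    [MulAction G T₁] [MulAction G T₂]
    (hT₁ : IsRTree T₁) (hT₂ : IsRTree T₂)
    (hiso₁ : IsometricAction G T₁) (hiso₂ : IsometricAction G T₂)
    (hmin₁ : MinimalAction G T₁) (hmin₂ : MinimalAction G T₂)
    (hne : (Core G T₁ T₂).Nonempty) :
    (∃ (T₀ : GTree G) (f₁ : T₀.carrier → T₁) (f₂ : T₀.carrier → T₂),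
        IsRefinementMap G f₁ ∧ IsRefinementMap G f₂) ↔
    (∀ (a₁ b₁ : T₁) (a₂ b₂ : T₂), a₁ ≠ b₁ → a₂ ≠ b₂ →
        ¬ (seg a₁ b₁ ×ˢ seg a₂ b₂ ⊆ Core G T₁ T₂)) := by
  constructor
  · rintro ⟨T₀, f₁, f₂, hf₁, hf₂⟩ a₁ b₁ a₂ b₂ h₁ h₂
    have : Nonempty T₀.carrier := (hf₁.2.1 a₁).nonempty
    exact not_rectangle_subset_core T₀.tree hT₁ hT₂ hf₁ hf₂ h₁ h₂
  · exact fun h => exists_common_refinement hT₁ hT₂ hiso₁ hiso₂ hmin₁ hmin₂ hne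
      (noncrossing_core hT₁ hT₂ h) fun g _ hz => smul_mem_core hT₁ hT₂ hiso₁ hiso₂ g hz

end Guirardel
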